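/- Let X be a locally finite building. Then the minimal combinatorial compactification Cc(X) is Aut(X)-equivariantly homeomorphic to the horofunction compactification of the chamber graph (ch(X) with the gallery distance), and the maximal combinatorial compactification Cr(X) is Aut(X)-equivariantly homeomorphic to the horofunction compactification of (Res(X), d) where d is the root-distance; in each case the homeomorphism extends the canonical identifications C ↦ f_C and R ↦ f_R on ch(X) and Res(X). -/

import Mathlib

open Filter Topology

noncomputable section

variable {B : Type} {W : Type} [Group W] {M : CoxeterMatrix B}

/-- The subset `I` of the simple reflections is of *spherical type* if the standard
parabolic subgroup `W_I` it generates is finite. -/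
def SphType (cs : CoxeterSystem M W) (I : Set B) : Prop :=
  ((Subgroup.closure (cs.simple '' I) : Subgroup W) : Set W).Finite

/-- A building of type `(W,S)`, in the chamber-system (`W`-metric) approach:
a nonempty set of chambers with a Weyl-group-valued distance function `delta`. -/
structure Bldg (cs : CoxeterSystem M W) where
  Chamber : Type
  chamber_nonempty : Nonempty Chamber
  delta : Chamber → Chamber → W
  delta_eq_one_iff : ∀ C D, delta C D = 1 ↔ C = D
  delta_mem_pair : ∀ C D E (i : B), delta D E = cs.simple i →
    delta C E = delta C D * cs.simple i ∨ delta C E = delta C D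
  delta_eq_of_length : ∀ C D E (i : B), delta D E = cs.simple i →
    cs.length (delta C D * cs.simple i) = cs.length (delta C D) + 1 →
    delta C E = delta C D * cs.simple i
  exists_delta : ∀ C D (i : B), ∃ E, delta D E = cs.simple i ∧
    delta C E = delta C D * cs.simple i

namespace Bldg

variable {cs : CoxeterSystem M W} (X : Bldg cs)

instance : Nonempty X.Chamber := X.chamber_nonempty

instance : TopologicalSpace X.Chamber := ⊥
instance : DiscreteTopology X.Chamber := ⟨rfl⟩

/-- The gallery distance between two chambers. -/
def gdist (C D : X.Chamber) : ℕ := cs.length (X.delta C D)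

/-- The `I`-residue of the chamber `C`. -/
def residue (I : Set B) (C : X.Chamber) : Set X.Chamber :=
  {D | X.delta C D ∈ Subgroup.closure (cs.simple '' I)}

/-- `R` is a spherical residue. -/
def IsSphResidue (R : Set X.Chamber) : Prop :=
  ∃ (I : Set B) (C : X.Chamber), SphType cs I ∧ R = X.residue I C

/-- `R` is a panel, i.e. an `{s}`-residue. -/
def IsPanel (R : Set X.Chamber) : Prop :=
  ∃ (i : B) (C : X.Chamber), R = X.residue {i} C

/-- The set `Res(X)` of spherical residues of `X`. -/
def Res : Type := {R : Set X.Chamber // X.IsSphResidue R}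

/-- The set of panels of `X`. -/
def Panel : Type := {R : Set X.Chamber // X.IsPanel R}

instance : Nonempty X.Res := by
  obtain ⟨C⟩ := X.chamber_nonempty
  exact ⟨⟨X.residue ∅ C, ∅, C, by simp [SphType], rfl⟩⟩

instance : TopologicalSpace X.Res := ⊥
instance : DiscreteTopology X.Res := ⟨rfl⟩

/-- `R₁ ≤ R₂` : the spherical residue `R₂` contains `R₁`, i.e. `R₂ ⊆ R₁` as
sets of chambers. -/
def leRes (R₁ R₂ : X.Res) : Prop := R₂.1 ⊆ R₁.1

/-- The star `St(σ)` of a spherical residue. -/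
def star (σ : X.Res) : Set X.Res := {τ | X.leRes σ τ}

/-- The gate (combinatorial projection) of the chamber `C` onto the residue `R` :
the unique chamber of `R` through which pass minimal galleries from `C` to any
chamber of `R`. -/
def gate (R : Set X.Chamber) (C : X.Chamber) : X.Chamber :=
  Classical.epsilon fun D => D ∈ R ∧ ∀ E ∈ R, X.gdist C E = X.gdist C D + X.gdist D E

/-- The combinatorial projection of the residue `T` onto the residue `R`,
as a set of chambers. -/
def projSet (R T : Set X.Chamber) : Set X.Chamber := X.gate R '' T

/-- The combinatorial projection `proj_R(T)` of the spherical residue `T` onto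
the spherical residue `R`, as a spherical residue. -/
def projRes (R T : X.Res) : X.Res :=
  Classical.epsilon fun U : X.Res => U.1 = X.projSet R.1 T.1

/-- The map `proj_r : Res(X) → ∏_σ St(σ)` underlying the maximal combinatorial
bordification. -/
def projr (R : X.Res) : X.Res → X.Res := fun σ => X.projRes σ R

/-- The maximal combinatorial bordification `Cr(X)`: the closure of the image
of `proj_r`, each factor of the product being discrete. -/
def Cr : Set (X.Res → X.Res) := closure (Set.range X.projr)

/-- The map `proj_c : ch(X) → ∏_{σ panel} St(σ)` underlying the minimal
combinatorial bordification. -/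
def projc (C : X.Chamber) : X.Panel → X.Chamber := fun σ => X.gate σ.1 C

/-- The minimal combinatorial bordification `Cc(X)`. -/
def Cc : Set (X.Panel → X.Chamber) := closure (Set.range X.projc)

/-- A set of spherical residues is closed if it contains, with any residue,
all residues that it contains (in the order `leRes`). -/
def ClosedResSet (𝓡 : Set X.Res) : Prop :=
  ∀ R₁ R₂ : X.Res, X.leRes R₁ R₂ → R₂ ∈ 𝓡 → R₁ ∈ 𝓡

/-- A set of spherical residues is convex if it is closed and stable under
combinatorial projections. -/
def ConvexResSet (𝓡 : Set X.Res) : Prop :=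
  X.ClosedResSet 𝓡 ∧ ∀ R₁ ∈ 𝓡, ∀ R₂ ∈ 𝓡, X.projRes R₁ R₂ ∈ 𝓡

/-- The closure of a set of spherical residues. -/
def resClosure (𝓡 : Set X.Res) : Set X.Res := ⋂₀ {𝓢 | X.ClosedResSet 𝓢 ∧ 𝓡 ⊆ 𝓢}

/-- The convex hull of a set of spherical residues. -/
def convHull (𝓡 : Set X.Res) : Set X.Res := ⋂₀ {𝓢 | X.ConvexResSet 𝓢 ∧ 𝓡 ⊆ 𝓢}

/-- The convex hull `Conv(R₁,R₂)` of two spherical residues. -/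
def conv2 (R₁ R₂ : X.Res) : Set X.Res := X.convHull {R₁, R₂}

/-- `α : W → ch(X)` is an apartment map: an isometric embedding of the Coxeter
complex. -/
def IsApartMap (α : W → X.Chamber) : Prop :=
  Function.Injective α ∧ ∀ v w : W, X.delta (α v) (α w) = v⁻¹ * w

/-- `A` is an apartment of `X`. -/
def IsApartment (A : Set X.Chamber) : Prop :=
  ∃ α : W → X.Chamber, X.IsApartMap α ∧ A = Set.range α

/-- The residue `R` lies in the apartment `A`. -/
def LiesIn (R : X.Res) (A : Set X.Chamber) : Prop := (R.1 ∩ A).Nonempty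

/-- `φ` is a root (half-apartment) of the apartment `A`. -/
def IsRootOf (A φ : Set X.Chamber) : Prop :=
  ∃ α : W → X.Chamber, X.IsApartMap α ∧ A = Set.range α ∧
    ∃ t : W, cs.IsReflection t ∧ φ = α '' {v : W | cs.length v < cs.length (t * v)}

/-- The residue `R` is contained in the root `φ` of the apartment `A`. -/
def ContainedInRoot (R : X.Res) (A φ : Set X.Chamber) : Prop := R.1 ∩ A ⊆ φ

/-- `Φ_A(R₁,R₂)`: the set of roots of `A` containing `R₁` but not `R₂`. -/
def PhiSep (A : Set X.Chamber) (R₁ R₂ : X.Res) : Set (Set X.Chamber) :=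
  {φ | X.IsRootOf A φ ∧ X.ContainedInRoot R₁ A φ ∧ ¬ X.ContainedInRoot R₂ A φ}

/-- A choice of apartment in which both `R₁` and `R₂` lie. -/
def chooseApt (R₁ R₂ : X.Res) : Set X.Chamber :=
  Classical.epsilon fun A : Set X.Chamber => X.IsApartment A ∧ X.LiesIn R₁ A ∧ X.LiesIn R₂ A

/-- The root-distance between two spherical residues:
`d(R₁,R₂) = ½|Φ_A(R₁,R₂)| + ½|Φ_A(R₂,R₁)|` for an apartment `A` containing both. -/
def rootDist (R₁ R₂ : X.Res) : ℝ :=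
  (((X.PhiSep (X.chooseApt R₁ R₂) R₁ R₂).ncard +
    (X.PhiSep (X.chooseApt R₁ R₂) R₂ R₁).ncard : ℕ) : ℝ) / 2

/-- The interval `[R₁,R₂]` determined by two spherical residues. -/
def interval (R₁ R₂ : X.Res) : Set X.Res :=
  {σ | X.rootDist R₁ R₂ = X.rootDist R₁ σ + X.rootDist σ R₂}

/-- The retraction onto the apartment given by the apartment map `α`, centred at
the chamber `α 1`. -/
def retr (α : W → X.Chamber) (D : X.Chamber) : X.Chamber := α (X.delta (α 1) D)

/-- The retraction onto an apartment, acting on spherical residues: it maps the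
`I`-residue of a chamber `D` to the `I`-residue of the retracted chamber. -/
def retrRes (α : W → X.Chamber) (R : X.Res) : X.Res :=
  Classical.epsilon fun T : X.Res =>
    ∃ (I : Set B) (D : X.Chamber), R.1 = X.residue I D ∧ T.1 = X.residue I (X.retr α D)

/-- The sequence `(R_n)` of spherical residues converges to `ξ` in the maximal
combinatorial bordification. -/
def ConvSeq (ξ : X.Res → X.Res) (R : ℕ → X.Res) : Prop :=
  Tendsto (fun n => X.projr (R n)) atTop (nhds ξ)

/-- `Q(x, (R_n)) = ⋃_k ⋂_{n ≥ k} Conv(x, R_n)`. -/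
def Qseq (x : X.Res) (R : ℕ → X.Res) : Set X.Res :=
  ⋃ k : ℕ, ⋂ n : ℕ, ⋂ _ : k ≤ n, X.conv2 x (R n)

/-- The combinatorial sector `Q(x,ξ)` based at `x` and pointing towards `ξ`. -/
def Qsector (x : X.Res) (ξ : X.Res → X.Res) : Set X.Res :=
  X.Qseq x (Classical.epsilon (X.ConvSeq ξ))

/-- `Φ_A(ξ)`: the set of roots of the apartment `A` (with apartment map `α`) in
which every sequence of residues converging to `ξ`, retracted to `A`, eventually
lies. -/
def PhiXi (A : Set X.Chamber) (α : W → X.Chamber) (ξ : X.Res → X.Res) :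
    Set (Set X.Chamber) :=
  {φ | X.IsRootOf A φ ∧ ∀ R : ℕ → X.Res, X.ConvSeq ξ R →
    ∃ N : ℕ, ∀ n > N, X.ContainedInRoot (X.retrRes α (R n)) A φ}

/-- `Φ_A(x)`: the set of roots of `A` containing the residue `x`. -/
def PhiRes (A : Set X.Chamber) (x : X.Res) : Set (Set X.Chamber) :=
  {φ | X.IsRootOf A φ ∧ X.ContainedInRoot x A φ}

/-- The spherical residue `x` is a chamber (an `∅`-residue). -/
def IsChamberRes (x : X.Res) : Prop :=
  ∃ C : X.Chamber, x.1 = X.residue (∅ : Set B) C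

/-- The automorphism group of the building: all permutations of the chambers
preserving the Weyl distance. -/
def autGroup : Subgroup (Equiv.Perm X.Chamber) where
  carrier := {g | ∀ C D : X.Chamber, X.delta (g C) (g D) = X.delta C D}
  one_mem' := by intro C D; simp
  mul_mem' := by
    intro a b ha hb C D
    simp only [Equiv.Perm.mul_apply]
    rw [ha, hb]
  inv_mem' := by
    intro a ha C D
    have := ha (a⁻¹ C) (a⁻¹ D)
    simpa using this.symm

/-- `Aut(X)` as a type. -/
abbrev Aut : Type := ↥X.autGroup

/-- The topology of pointwise convergence on `Aut(X)` (the chamber set being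
discrete). -/
instance : TopologicalSpace X.Aut :=
  TopologicalSpace.induced
    (fun g : X.Aut => ((g : Equiv.Perm X.Chamber) : X.Chamber → X.Chamber)) inferInstance

/-- The action of an automorphism on spherical residues. -/
def actRes (g : X.Aut) (R : X.Res) : X.Res :=
  Classical.epsilon fun T : X.Res => T.1 = (g : Equiv.Perm X.Chamber) '' R.1

/-- The action of an automorphism on panels. -/
def actPanel (g : X.Aut) (σ : X.Panel) : X.Panel :=
  haveI : Nonempty X.Panel := ⟨σ⟩
  Classical.epsilon fun τ : X.Panel => τ.1 = (g : Equiv.Perm X.Chamber) '' σ.1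

/-- The action of `Aut(X)` on the maximal combinatorial bordification:
`(g·f)(σ) = g·f(g⁻¹σ)`. -/
def actCr (g : X.Aut) (f : X.Res → X.Res) : X.Res → X.Res :=
  fun σ => X.actRes g (f (X.actRes g⁻¹ σ))

/-- The action of `Aut(X)` on the minimal combinatorial bordification. -/
def actCc (g : X.Aut) (f : X.Panel → X.Chamber) : X.Panel → X.Chamber :=
  fun σ => (g : Equiv.Perm X.Chamber) (f (X.actPanel g⁻¹ σ))

/-- The building is locally finite: `S` is finite and panels are finite. -/
def LocallyFinite : Prop :=
  Finite B ∧ ∀ R : Set X.Chamber, X.IsPanel R → R.Finite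

/-- The building is thick: every panel contains at least three chambers. -/
def Thick : Prop := ∀ R : Set X.Chamber, X.IsPanel R → 3 ≤ R.ncard

/-- The subgroup `G ≤ Aut(X)` acts strongly transitively: transitively on pairs
`(C, A)` of a chamber contained in an apartment. -/
def StronglyTransitive (G : Subgroup X.Aut) : Prop :=
  ∀ (C C' : X.Chamber) (A A' : Set X.Chamber),
    X.IsApartment A → C ∈ A → X.IsApartment A' → C' ∈ A' →
    ∃ g ∈ G, (g : Equiv.Perm X.Chamber) C = C' ∧ (g : Equiv.Perm X.Chamber) '' A = A'

end Bldg

/-- A topological group is amenable if there is a left-invariant mean on the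
space of bounded continuous real-valued functions on it. -/
def IsAmenableGroup (H : Type*) [Group H] [TopologicalSpace H] : Prop :=
  ∃ m : BoundedContinuousFunction H ℝ →ₗ[ℝ] ℝ,
    m 1 = 1 ∧ (∀ f : BoundedContinuousFunction H ℝ, (∀ x, 0 ≤ f x) → 0 ≤ m f) ∧
    ∀ (g : H) (f₁ f₂ : BoundedContinuousFunction H ℝ),
      (∀ x, f₂ x = f₁ (g * x)) → m f₂ = m f₁

/-- A subset `K` of a topological group is topologically locally finite if every
finite subset of `K` generates a subgroup with compact closure. -/
def IsTLFSet {H : Type*} [Group H] [TopologicalSpace H] (K : Set H) : Prop :=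
  ∀ s : Finset H, (s : Set H) ⊆ K →
    IsCompact (closure ((Subgroup.closure (s : Set H) : Subgroup H) : Set H))

/-- The space of closed subgroups of a topological group. -/
def ChabautySpace (H : Type*) [Group H] [TopologicalSpace H] : Type _ :=
  {K : Subgroup H // IsClosed (K : Set H)}

instance {H : Type*} [Group H] [TopologicalSpace H] : Nonempty (ChabautySpace H) :=
  ⟨⟨⊤, by rw [Subgroup.coe_top]; exact isClosed_univ⟩⟩

/-- The Chabauty topology on the space of closed subgroups. -/
instance {H : Type*} [Group H] [TopologicalSpace H] : TopologicalSpace (ChabautySpace H) :=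
  TopologicalSpace.generateFrom
    ({s | ∃ K : Set H, IsCompact K ∧ s = {L : ChabautySpace H | (L.1 : Set H) ∩ K = ∅}} ∪
     {s | ∃ U : Set H, IsOpen U ∧ s = {L : ChabautySpace H | ((L.1 : Set H) ∩ U).Nonempty}})

namespace Bldg

variable {cs : CoxeterSystem M W} (X : Bldg cs)

/-- The stabiliser in `G` of a spherical residue, as a set. -/
def gstab (G : Subgroup X.Aut) (R : X.Res) : Set ↥G :=
  {g : ↥G | X.actRes (g : X.Aut) R = R}

/-- The stabiliser in `G` of a spherical residue, as a closed subgroup of `G`. -/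
def gstabC (G : Subgroup X.Aut) (R : X.Res) : ChabautySpace ↥G :=
  Classical.epsilon fun L : ChabautySpace ↥G => (L.1 : Set ↥G) = X.gstab G R

/-- `D_ξ`: the union over `x ∈ Res(X)` of the pointwise fixators in `G` of the
combinatorial sectors `Q(x,ξ)`. -/
def gfixSector (G : Subgroup X.Aut) (ξ : X.Res → X.Res) : Set ↥G :=
  {g : ↥G | ∃ x : X.Res, ∀ R ∈ X.Qsector x ξ, X.actRes (g : X.Aut) R = R}

/-- `D_ξ` as a closed subgroup of `G` (an element of the Chabauty space). -/
def DxiC (G : Subgroup X.Aut) (ξ : X.Res → X.Res) : ChabautySpace ↥G :=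
  Classical.epsilon fun L : ChabautySpace ↥G => (L.1 : Set ↥G) = X.gfixSector G ξ

/-- The set of periodic elements of the stabiliser `G_ξ`. -/
def periodicStab (G : Subgroup X.Aut) (ξ : X.Res → X.Res) : Set ↥G :=
  {g : ↥G | X.actCr (g : X.Aut) ξ = ξ ∧
    IsCompact (closure ((Subgroup.zpowers g : Subgroup ↥G) : Set ↥G))}

/-- The horofunction compactification of the chamber graph, with base point `y₀`. -/
def horoCh (y₀ : X.Chamber) : Set (X.Chamber → ℝ) :=
  closure (Set.range fun C : X.Chamber =>
    fun y : X.Chamber => (X.gdist C y : ℝ) - (X.gdist C y₀ : ℝ))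

/-- The horofunction compactification of `(Res(X), root-distance)`, with base
point `z₀`. -/
def horoRes (z₀ : X.Res) : Set (X.Res → ℝ) :=
  closure (Set.range fun R : X.Res =>
    fun y : X.Res => X.rootDist R y - X.rootDist R z₀)

/-- The action of `Aut(X)` on horofunctions of the chamber graph. -/
def actHoroCh (y₀ : X.Chamber) (g : X.Aut) (h : X.Chamber → ℝ) : X.Chamber → ℝ :=
  fun y => h (((g⁻¹ : X.Aut) : Equiv.Perm X.Chamber) y) -
    h (((g⁻¹ : X.Aut) : Equiv.Perm X.Chamber) y₀)

/-- The action of `Aut(X)` on horofunctions of `(Res(X), root-distance)`. -/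
def actHoroRes (z₀ : X.Res) (g : X.Aut) (h : X.Res → ℝ) : X.Res → ℝ :=
  fun y => h (X.actRes g⁻¹ y) - h (X.actRes g⁻¹ z₀)

end Bldg

namespace CoxeterSystem

variable (cs : CoxeterSystem M W)

open Classical in
/-- The involution of `W × ℤ/2` attached to a simple reflection: conjugation on the first factor,
together with a flip of the sign at the reflection itself. -/
def signPerm (i : B) : Equiv.Perm (W × ZMod 2) where
  toFun p := (cs.simple i * p.1 * cs.simple i, p.2 + if p.1 = cs.simple i then 1 else 0)
  invFun p := (cs.simple i * p.1 * cs.simple i, p.2 + if p.1 = cs.simple i then 1 else 0)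
  left_inv p := by
    have h : cs.simple i * p.1 * cs.simple i = cs.simple i ↔ p.1 = cs.simple i := by
      constructor
      · intro h
        have := congrArg (fun x => cs.simple i * x * cs.simple i) h
        simpa [mul_assoc] using this
      · intro h; simp [h]
    ext
    · simp [mul_assoc]
    · simp only [h, add_assoc, CharTwo.add_self_eq_zero, add_zero]
  right_inv p := by
    have h : cs.simple i * p.1 * cs.simple i = cs.simple i ↔ p.1 = cs.simple i := by
      constructor
      · intro h
        have := congrArg (fun x => cs.simple i * x * cs.simple i) h
        simpa [mul_assoc] using this
      · intro h; simp [h]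
    ext
    · simp [mul_assoc]
    · simp only [h, add_assoc, CharTwo.add_self_eq_zero, add_zero]

open Classical in
theorem signPerm_mul_pow_apply (i j : B) (k : ℕ) (t : W) (ε : ZMod 2) :
    ((cs.signPerm i * cs.signPerm j) ^ k) (t, ε) =
      ((cs.simple i * cs.simple j) ^ k * t * ((cs.simple i * cs.simple j) ^ k)⁻¹,
        ε + ∑ n ∈ Finset.range (2 * k),
          if t = ((cs.simple i * cs.simple j) ^ n)⁻¹ * cs.simple j then 1 else 0) := by
  set c := cs.simple i * cs.simple j with hc
  have hconj : ∀ l : ℕ, cs.simple j * c ^ l = (c ^ l)⁻¹ * cs.simple j := by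
    intro l
    induction l with
    | zero => simp
    | succ l ih =>
      have h1 : (c ^ l)⁻¹ * c⁻¹ = c⁻¹ * (c ^ l)⁻¹ := by
        rw [← mul_inv_rev, ← mul_inv_rev, ← pow_succ, ← pow_succ']
      have h2 : cs.simple j * (cs.simple i * cs.simple j) = c⁻¹ * cs.simple j := by
        simp [hc, mul_assoc]
      rw [pow_succ, ← mul_assoc, ih, mul_assoc, h2, ← mul_assoc, h1, ← mul_inv_rev]
  induction k with
  | zero => simp
  | succ k ih =>
    have e1 : c ^ k * t * (c ^ k)⁻¹ = cs.simple j ↔ t = (c ^ (2 * k))⁻¹ * cs.simple j := by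
      rw [mul_inv_eq_iff_eq_mul, hconj, ← eq_inv_mul_iff_mul_eq, ← mul_assoc, ← mul_inv_rev,
        ← pow_add, two_mul]
    have e2 : cs.simple j * (c ^ k * t * (c ^ k)⁻¹) * cs.simple j = cs.simple i ↔
        t = (c ^ (2 * k + 1))⁻¹ * cs.simple j := by
      have h3 : (c ^ (2 * k + 1))⁻¹ * cs.simple j =
          (c ^ k)⁻¹ * (cs.simple j * cs.simple i * cs.simple j) * c ^ k := by
        have h4 : cs.simple j * cs.simple i * cs.simple j = c⁻¹ * cs.simple j := by
          simp [hc]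
        rw [h4, mul_assoc, mul_assoc, hconj, ← mul_assoc c⁻¹, ← mul_inv_rev, ← pow_succ,
          ← mul_assoc, ← mul_inv_rev, ← pow_add]
        congr 3; ring
      rw [h3]
      constructor
      · intro h
        rw [← h]
        simp [mul_assoc]
      · intro h
        rw [h]
        simp [mul_assoc]
    rw [pow_succ', Equiv.Perm.mul_apply, ih, Equiv.Perm.mul_apply]
    simp only [signPerm, Equiv.coe_fn_mk]
    rw [show 2 * (k + 1) = 2 * k + 1 + 1 by ring, Finset.sum_range_succ, Finset.sum_range_succ]
    refine Prod.ext ?_ ?_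
    · simp only [pow_succ' c k, mul_inv_rev]
      simp [hc, mul_assoc]
    · simp only [e1, e2]
      ring

theorem signPerm_isLiftable : M.IsLiftable cs.signPerm := by
  classical
  intro i j
  refine Equiv.ext fun p => ?_
  obtain ⟨t, ε⟩ := p
  rw [signPerm_mul_pow_apply, cs.simple_mul_simple_pow]
  have h : ∑ n ∈ Finset.range (2 * M i j),
      (if t = ((cs.simple i * cs.simple j) ^ n)⁻¹ * cs.simple j then (1 : ZMod 2) else 0) = 0 := by
    rw [two_mul, Finset.sum_range_add]
    simp only [pow_add, cs.simple_mul_simple_pow, one_mul]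
    exact CharTwo.add_self_eq_zero _
  rw [h]
  simp

/-- The sign representation of `W` on `W × ℤ/2`. -/
def signRep : W →* Equiv.Perm (W × ZMod 2) := cs.lift ⟨cs.signPerm, cs.signPerm_isLiftable⟩

theorem signRep_simple (i : B) : cs.signRep (cs.simple i) = cs.signPerm i :=
  cs.lift_apply_simple cs.signPerm_isLiftable i

open Classical in
theorem signRep_wordProd_apply (ω : List B) (t : W) (ε : ZMod 2) :
    cs.signRep (cs.wordProd ω) (t, ε) =
      (cs.wordProd ω * t * (cs.wordProd ω)⁻¹, ε + ((cs.rightInvSeq ω).count t : ℕ)) := by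
  induction ω with
  | nil => simp [wordProd]
  | cons i ω ih =>
    rw [wordProd_cons, map_mul, Equiv.Perm.mul_apply, ih, signRep_simple]
    simp only [signPerm, Equiv.coe_fn_mk, rightInvSeq, List.count_cons]
    have e : cs.wordProd ω * t * (cs.wordProd ω)⁻¹ = cs.simple i ↔
        (cs.wordProd ω)⁻¹ * cs.simple i * cs.wordProd ω = t := by
      constructor
      · intro h; rw [← h]; group
      · intro h; rw [← h]; group
    refine Prod.ext ?_ ?_
    · simp [mul_assoc]
    · simp only [e, beq_iff_eq]
      push_cast
      ring

/-- The parity cocycle whose value at a reflection `t` detects whether `t` is a right inversion. -/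
def invParity (w t : W) : ZMod 2 := (cs.signRep w (t, 0)).2

theorem signRep_apply (w t : W) (ε : ZMod 2) :
    cs.signRep w (t, ε) = (w * t * w⁻¹, ε + cs.invParity w t) := by
  classical
  obtain ⟨ω, rfl⟩ := cs.wordProd_surjective w
  simp [invParity, signRep_wordProd_apply]

theorem invParity_mul (u v t : W) :
    cs.invParity (u * v) t = cs.invParity v t + cs.invParity u (v * t * v⁻¹) := by
  rw [invParity, map_mul, Equiv.Perm.mul_apply, signRep_apply, signRep_apply]
  simp

theorem invParity_one (t : W) : cs.invParity 1 t = 0 := by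
  simp [invParity]

theorem invParity_simple_self (i : B) : cs.invParity (cs.simple i) (cs.simple i) = 1 := by
  simp [invParity, signRep_simple, signPerm]

theorem invParity_self {t : W} (ht : cs.IsReflection t) : cs.invParity t t = 1 := by
  obtain ⟨w, i, rfl⟩ := ht
  have h1 := cs.invParity_mul w w⁻¹ (w * cs.simple i * w⁻¹)
  rw [mul_inv_cancel, invParity_one] at h1
  rw [mul_assoc w, invParity_mul, invParity_mul]
  simp only [mul_assoc, inv_mul_cancel_left, inv_inv, inv_mul_cancel, mul_one,
    mul_inv_rev, invParity_simple_self, cs.inv_simple, cs.simple_mul_simple_cancel_left] at h1 ⊢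
  linear_combination -h1

theorem mem_rightInvSeq_of_invParity {ω : List B} {t : W}
    (h : cs.invParity (cs.wordProd ω) t = 1) : t ∈ cs.rightInvSeq ω := by
  classical
  by_contra hn
  rw [invParity, signRep_wordProd_apply, List.count_eq_zero_of_not_mem hn] at h
  simp at h

theorem isRightInversion_of_invParity {w t : W} (h : cs.invParity w t = 1) :
    cs.IsRightInversion w t := by
  obtain ⟨ω, hω, rfl⟩ := cs.exists_isReduced w
  exact cs.isRightInversion_of_mem_rightInvSeq hω (cs.mem_rightInvSeq_of_invParity h)

theorem isRightInversion_iff_invParity {w t : W} (ht : cs.IsReflection t) :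
    cs.IsRightInversion w t ↔ cs.invParity w t = 1 := by
  refine ⟨fun h => ?_, cs.isRightInversion_of_invParity⟩
  by_contra hn
  have h0 : cs.invParity w t = 0 := by
    generalize cs.invParity w t = x at hn
    revert x; decide
  have h1 : cs.invParity (w * t) t = 1 := by
    rw [invParity_mul, cs.invParity_self ht]
    simp [h0]
  have h2 := (cs.isRightInversion_of_invParity h1).2
  rw [mul_assoc, ht.mul_self, mul_one] at h2
  exact absurd h.2 (not_lt.mpr h2.le)

theorem isLeftInversion_iff_invParity {w t : W} (ht : cs.IsReflection t) :
    cs.IsLeftInversion w t ↔ cs.invParity w⁻¹ t = 1 := by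
  rw [← cs.isRightInversion_iff_invParity ht, cs.isRightInversion_inv_iff]

/-- The cocycle property of inversion sets. -/
theorem isLeftInversion_mul_iff {u v t : W} (ht : cs.IsReflection t) :
    cs.IsLeftInversion (u * v) t ↔
      ¬ (cs.IsLeftInversion u t ↔ cs.IsLeftInversion v (u⁻¹ * t * u)) := by
  have ht' : cs.IsReflection (u⁻¹ * t * u) := by simpa using ht.conj u⁻¹
  rw [cs.isLeftInversion_iff_invParity ht, cs.isLeftInversion_iff_invParity ht,
    cs.isLeftInversion_iff_invParity ht', mul_inv_rev, invParity_mul, inv_inv]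
  generalize cs.invParity u⁻¹ t = x
  generalize cs.invParity v⁻¹ (u⁻¹ * t * u) = y
  revert x y
  decide

theorem finite_isLeftInversion (w : W) : {t | cs.IsLeftInversion w t}.Finite := by
  obtain ⟨ω, hω⟩ := cs.wordProd_surjective w⁻¹
  refine (List.finite_toSet (cs.rightInvSeq ω)).subset fun t ht => ?_
  refine cs.mem_rightInvSeq_of_invParity ?_
  rw [hω]
  exact (cs.isLeftInversion_iff_invParity ht.1).1 ht

theorem IsLeftInversion.mul_right {u v t : W} (h : cs.IsLeftInversion u t)
    (hl : cs.length (u * v) = cs.length u + cs.length v) : cs.IsLeftInversion (u * v) t := by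
  refine ⟨h.1, ?_⟩
  have h1 := h.2
  have h2 := cs.length_mul_le (t * u) v
  rw [← mul_assoc]
  omega

/-- The standard parabolic subgroup `W_I`. -/
abbrev parabolic (I : Set B) : Subgroup W := Subgroup.closure (cs.simple '' I)

variable {cs} {I : Set B}

theorem exists_word_of_mem_parabolic {u : W} (hu : u ∈ cs.parabolic I) :
    ∃ ω : List B, (∀ i ∈ ω, i ∈ I) ∧ cs.wordProd ω = u := by
  induction hu using Subgroup.closure_induction with
  | mem x hx =>
    obtain ⟨i, hi, rfl⟩ := hx
    exact ⟨[i], by simpa using hi, by simp [wordProd]⟩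
  | one => exact ⟨[], by simp, by simp [wordProd]⟩
  | mul x y _ _ hx hy =>
    obtain ⟨a, ha, rfl⟩ := hx
    obtain ⟨b, hb, rfl⟩ := hy
    refine ⟨a ++ b, fun i hi => ?_, cs.wordProd_append a b⟩
    rcases List.mem_append.1 hi with h | h
    · exact ha i h
    · exact hb i h
  | inv x _ hx =>
    obtain ⟨a, ha, rfl⟩ := hx
    exact ⟨a.reverse, by simpa using ha, by simp⟩

theorem mem_parabolic_of_mem_rightInvSeq {ω : List B} (hω : ∀ i ∈ ω, i ∈ I) {t : W}
    (ht : t ∈ cs.rightInvSeq ω) : t ∈ cs.parabolic I := by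
  have hw : ∀ ω : List B, (∀ i ∈ ω, i ∈ I) → cs.wordProd ω ∈ cs.parabolic I := by
    intro ω hω
    refine Subgroup.list_prod_mem _ fun x hx => ?_
    obtain ⟨i, hi, rfl⟩ := List.mem_map.1 hx
    exact Subgroup.subset_closure ⟨i, hω i hi, rfl⟩
  induction ω with
  | nil => simp [rightInvSeq] at ht
  | cons i ω ih =>
    have htail : ∀ i ∈ ω, i ∈ I := fun j hj => hω j (List.mem_cons_of_mem _ hj)
    rw [rightInvSeq, List.mem_cons] at ht
    rcases ht with rfl | ht
    · exact mul_mem (mul_mem (inv_mem (hw ω htail))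
        (Subgroup.subset_closure ⟨i, hω i (by simp), rfl⟩)) (hw ω htail)
    · exact ih htail ht

/-- Inversions of an element of `W_I` lie in `W_I`. -/
theorem IsLeftInversion.mem_parabolic {u t : W} (hu : u ∈ cs.parabolic I)
    (h : cs.IsLeftInversion u t) : t ∈ cs.parabolic I := by
  obtain ⟨ω, hω, hp⟩ := exists_word_of_mem_parabolic (inv_mem hu)
  refine mem_parabolic_of_mem_rightInvSeq hω (cs.mem_rightInvSeq_of_invParity ?_)
  rw [hp]
  exact (cs.isLeftInversion_iff_invParity h.1).1 h

theorem exists_simple_mul_lt {u : W} (hu : u ∈ cs.parabolic I) (h1 : u ≠ 1) :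
    ∃ i, cs.simple i ∈ cs.parabolic I ∧ cs.length (cs.simple i * u) + 1 = cs.length u := by
  obtain ⟨i, hi⟩ := cs.exists_leftDescent_of_ne_one h1
  exact ⟨i, IsLeftInversion.mem_parabolic hu
    ((cs.isLeftInversion_simple_iff_isLeftDescent u i).2 hi), (cs.isLeftDescent_iff).1 hi⟩

theorem exists_mul_simple_lt {u : W} (hu : u ∈ cs.parabolic I) (h1 : u ≠ 1) :
    ∃ i, cs.simple i ∈ cs.parabolic I ∧ cs.length (u * cs.simple i) + 1 = cs.length u := by
  obtain ⟨i, hi, hl⟩ := exists_simple_mul_lt (inv_mem hu) (inv_ne_one.2 h1)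
  refine ⟨i, hi, ?_⟩
  rw [← cs.length_inv (u * cs.simple i), ← cs.length_inv u]
  simpa using hl

/-- Induction along reduced words inside a standard parabolic subgroup. -/
theorem parabolic_induction {p : W → Prop} {u : W} (hu : u ∈ cs.parabolic I) (one : p 1)
    (mul_simple : ∀ v i, v ∈ cs.parabolic I → cs.simple i ∈ cs.parabolic I →
      cs.length (v * cs.simple i) = cs.length v + 1 → p v → p (v * cs.simple i)) : p u := by
  induction hn : cs.length u generalizing u with
  | zero => rw [cs.length_eq_zero_iff.1 hn]; exact one
  | succ n ih =>
    have h1 : u ≠ 1 := by rintro rfl; simp at hn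
    obtain ⟨i, hi, hl⟩ := exists_mul_simple_lt hu h1
    have h2 := mul_simple (u * cs.simple i) i (mul_mem hu hi) hi
      (by rw [mul_assoc, cs.simple_mul_simple_self, mul_one]; exact hl.symm)
      (ih (mul_mem hu hi) (by omega))
    rwa [mul_assoc, cs.simple_mul_simple_self, mul_one] at h2

/-- Lengths add up along a coset `wW_I` when `w` is of minimal length in it. -/
theorem length_mul_of_forall_le {w u : W}
    (hw : ∀ v ∈ cs.parabolic I, cs.length w ≤ cs.length (w * v)) (hu : u ∈ cs.parabolic I) :
    cs.length (w * u) = cs.length w + cs.length u := by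
  refine parabolic_induction (cs := cs) (p := fun u => cs.length (w * u) =
    cs.length w + cs.length u) hu (by simp) ?_
  intro v i hv hi hl ih
  rcases cs.length_mul_simple (w * v) i with h | h
  · rw [← mul_assoc, h, ih, hl, add_assoc]
  · exfalso
    have h1 : cs.IsRightInversion (w * v) (cs.simple i) :=
      ⟨cs.isReflection_simple i, by omega⟩
    rw [cs.isRightInversion_iff_invParity (cs.isReflection_simple i), invParity_mul] at h1
    have h2 : ¬ cs.IsRightInversion v (cs.simple i) := fun h => by
      have := h.2
      omega
    rw [cs.isRightInversion_iff_invParity (cs.isReflection_simple i)] at h2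
    have h3 : cs.invParity w (v * cs.simple i * v⁻¹) = 1 := by
      revert h1 h2
      generalize cs.invParity v (cs.simple i) = x
      generalize cs.invParity w (v * cs.simple i * v⁻¹) = y
      revert x y
      decide
    have h4 := (cs.isRightInversion_of_invParity h3).2
    exact absurd h4 (not_lt.mpr (hw _ (mul_mem (mul_mem hv hi) (inv_mem hv))))

theorem length_mul_of_forall_le_left {w u : W}
    (hw : ∀ v ∈ cs.parabolic I, cs.length w ≤ cs.length (v * w)) (hu : u ∈ cs.parabolic I) :
    cs.length (u * w) = cs.length u + cs.length w := by
  have h := length_mul_of_forall_le (cs := cs) (I := I) (w := w⁻¹) (u := u⁻¹)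
    (fun v hv => by
      rw [cs.length_inv, ← cs.length_inv (w⁻¹ * v)]
      simpa using hw v⁻¹ (inv_mem hv)) (inv_mem hu)
  rw [← mul_inv_rev, cs.length_inv, cs.length_inv, cs.length_inv] at h
  omega

end CoxeterSystem

namespace CoxeterSystem

variable (cs : CoxeterSystem M W)

/-- The half-spaces (roots) of the Coxeter complex of `W`, as subsets of `W`. -/
def IsHalf (h : Set W) : Prop :=
  ∃ u t, cs.IsReflection t ∧ h = {x | cs.length (u⁻¹ * x) < cs.length (t * (u⁻¹ * x))}

variable {cs}

theorem lt_length_mul_iff {t x : W} (ht : cs.IsReflection t) :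
    cs.length x < cs.length (t * x) ↔ ¬ cs.IsLeftInversion x t := by
  have h1 := ht.length_mul_right_ne x
  constructor
  · intro h h'
    exact absurd h'.2 (by omega)
  · intro h
    have h2 : ¬ cs.length (t * x) < cs.length x := fun h' => h ⟨ht, h'⟩
    omega

theorem isHalf_iff {h : Set W} :
    cs.IsHalf h ↔ ∃ u t, cs.IsReflection t ∧ h = {x | ¬ cs.IsLeftInversion (u⁻¹ * x) t} := by
  constructor
  · rintro ⟨u, t, ht, rfl⟩
    exact ⟨u, t, ht, by ext x; exact lt_length_mul_iff ht⟩
  · rintro ⟨u, t, ht, rfl⟩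
    exact ⟨u, t, ht, by ext x; exact (lt_length_mul_iff ht).symm⟩

theorem IsHalf.preimage {h : Set W} (hh : cs.IsHalf h) (g : W) :
    cs.IsHalf ((fun x => g * x) ⁻¹' h) := by
  obtain ⟨u, t, ht, rfl⟩ := hh
  exact ⟨g⁻¹ * u, t, ht, by ext x; simp [mul_assoc]⟩

theorem IsHalf.compl {h : Set W} (hh : cs.IsHalf h) : cs.IsHalf hᶜ := by
  rw [isHalf_iff] at hh ⊢
  obtain ⟨u, t, ht, rfl⟩ := hh
  refine ⟨u * t, t, ht, ?_⟩
  ext x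
  have h1 := cs.isLeftInversion_mul_iff (u := t) (v := u⁻¹ * x) ht
  have h2 : cs.IsLeftInversion t t :=
    (cs.isLeftInversion_iff_invParity ht).2 (by rw [ht.inv]; exact cs.invParity_self ht)
  rw [ht.inv, ht.mul_self, one_mul] at h1
  simp only [Set.mem_compl_iff, Set.mem_ofPred_eq, mul_inv_rev, ht.inv, mul_assoc, h1, h2, true_iff]

theorem IsHalf.exists_eq {h : Set W} (hh : cs.IsHalf h) {p : W} (hp : p ∈ h) :
    ∃ t, cs.IsReflection t ∧ h = {x | ¬ cs.IsLeftInversion (p⁻¹ * x) t} := by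
  rw [isHalf_iff] at hh
  obtain ⟨u, t, ht, rfl⟩ := hh
  refine ⟨(u⁻¹ * p)⁻¹ * t * (u⁻¹ * p), by simpa using ht.conj (u⁻¹ * p)⁻¹, ?_⟩
  ext x
  have h1 := cs.isLeftInversion_mul_iff (u := u⁻¹ * p) (v := p⁻¹ * x) ht
  have h2 : ¬ cs.IsLeftInversion (u⁻¹ * p) t := hp
  rw [mul_assoc u⁻¹, mul_inv_cancel_left] at h1
  simp only [Set.mem_ofPred_eq, h1, h2, false_iff, not_not]

theorem IsHalf.mem_of_length_eq {h : Set W} (hh : cs.IsHalf h) {x g y : W} (hx : x ∈ h)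
    (hy : y ∈ h) (hl : cs.length (x⁻¹ * y) = cs.length (x⁻¹ * g) + cs.length (g⁻¹ * y)) :
    g ∈ h := by
  obtain ⟨t, ht, rfl⟩ := hh.exists_eq hx
  intro hg
  have e : x⁻¹ * y = (x⁻¹ * g) * (g⁻¹ * y) := by group
  refine hy ?_
  rw [e]
  refine IsLeftInversion.mul_right cs hg ?_
  rw [← e, hl]

theorem finite_half_separating (p q : W) : {h | cs.IsHalf h ∧ p ∈ h ∧ q ∉ h}.Finite := by
  refine ((cs.finite_isLeftInversion (p⁻¹ * q)).image
    fun t => {x | ¬ cs.IsLeftInversion (p⁻¹ * x) t}).subset ?_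
  rintro h ⟨hh, hp, hq⟩
  obtain ⟨t, ht, rfl⟩ := hh.exists_eq hp
  exact ⟨t, by simpa using hq, rfl⟩

variable (cs) in
/-- The half-spaces containing `P` but not `Q`. -/
def halfSep (P Q : Set W) : Set (Set W) := {h | cs.IsHalf h ∧ P ⊆ h ∧ ¬ Q ⊆ h}

theorem finite_halfSep {P Q : Set W} (hP : P.Nonempty) (hQ : Q.Finite) :
    (cs.halfSep P Q).Finite := by
  obtain ⟨p, hp⟩ := hP
  refine (hQ.biUnion fun q _ => finite_half_separating (cs := cs) p q).subset ?_
  rintro h ⟨hh, h1, h2⟩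
  obtain ⟨q, hq, hqh⟩ := Set.not_subset.1 h2
  exact Set.mem_biUnion hq ⟨hh, h1 hp, hqh⟩

theorem ncard_halfSep_preimage (g : W) (P Q : Set W) :
    (cs.halfSep ((fun x => g * x) ⁻¹' P) ((fun x => g * x) ⁻¹' Q)).ncard =
      (cs.halfSep P Q).ncard := by
  have hs : Function.Surjective (fun x : W => g * x) := fun y => ⟨g⁻¹ * y, by simp⟩
  have e : cs.halfSep ((fun x => g * x) ⁻¹' P) ((fun x => g * x) ⁻¹' Q) =
      (fun h => (fun x => g * x) ⁻¹' h) '' cs.halfSep P Q := by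
    ext h
    constructor
    · rintro ⟨hh, h1, h2⟩
      have e : (fun x => g * x) ⁻¹' ((fun x => g⁻¹ * x) ⁻¹' h) = h := by ext x; simp
      refine ⟨(fun x => g⁻¹ * x) ⁻¹' h, ⟨hh.preimage _, ?_, ?_⟩, e⟩
      · rw [← e] at h1
        exact (Set.preimage_subset_preimage_iff (by rw [hs.range_eq]; exact P.subset_univ)).1 h1
      · rw [← e] at h2
        exact fun h3 => h2 (Set.preimage_mono h3)
    · rintro ⟨h, ⟨hh, h1, h2⟩, rfl⟩
      exact ⟨hh.preimage _, Set.preimage_mono h1, fun h3 => h2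
        ((Set.preimage_subset_preimage_iff (by rw [hs.range_eq]; exact Q.subset_univ)).1 h3)⟩
  rw [e, Set.ncard_image_of_injective _ hs.preimage_injective]

/-- Comparison of root-distances to a coset `S` and to a smaller coset `T ⊆ S`. -/
theorem ncard_halfSep_add_eq {P P' S T : Set W} (hTS : T ⊆ S) (hP : P.Nonempty)
    (hP' : P'.Nonempty) (hT : T.Nonempty) (hPf : P.Finite) (hPf' : P'.Finite) (hS : S.Finite)
    (hside : ∀ h, cs.IsHalf h → T ⊆ h → ¬ S ⊆ h → (P ⊆ h ↔ P' ⊆ h)) :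
    ((cs.halfSep P T).ncard + (cs.halfSep T P).ncard) +
      ((cs.halfSep P' S).ncard + (cs.halfSep S P').ncard) =
    ((cs.halfSep P S).ncard + (cs.halfSep S P).ncard) +
      ((cs.halfSep P' T).ncard + (cs.halfSep T P').ncard) := by
  have key : ∀ Q : Set W, Q.Nonempty → Q.Finite →
      (cs.halfSep Q S).ncard =
        (cs.halfSep Q T).ncard + {h | cs.IsHalf h ∧ T ⊆ h ∧ ¬ S ⊆ h ∧ Q ⊆ h}.ncard ∧
      (cs.halfSep T Q).ncard =
        (cs.halfSep S Q).ncard + {h | cs.IsHalf h ∧ T ⊆ h ∧ ¬ S ⊆ h ∧ ¬ Q ⊆ h}.ncard := by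
    intro Q hQ hQf
    constructor
    · rw [← Set.ncard_union_eq ?_ ?_ ?_]
      · congr 1
        ext h
        simp only [halfSep, Set.mem_union, Set.mem_ofPred_eq]
        have : S ⊆ h → T ⊆ h := hTS.trans
        tauto
      · rw [Set.disjoint_left]
        rintro h ⟨_, _, h1⟩ ⟨_, h2, _⟩
        exact h1 h2
      · exact finite_halfSep hQ (hS.subset hTS)
      · exact (finite_halfSep hQ hS).subset fun h hh => ⟨hh.1, hh.2.2.2, hh.2.2.1⟩
    · rw [← Set.ncard_union_eq ?_ ?_ ?_]
      · congr 1
        ext h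
        simp only [halfSep, Set.mem_union, Set.mem_ofPred_eq]
        have : S ⊆ h → T ⊆ h := hTS.trans
        tauto
      · rw [Set.disjoint_left]
        rintro h ⟨_, h1, _⟩ ⟨_, _, h2, _⟩
        exact h2 h1
      · exact finite_halfSep (hT.mono hTS) hQf
      · exact (finite_halfSep hT hQf).subset fun h hh => ⟨hh.1, hh.2.1, hh.2.2.2⟩
  obtain ⟨a1, a2⟩ := key P hP hPf
  obtain ⟨b1, b2⟩ := key P' hP' hPf'
  have c1 : {h | cs.IsHalf h ∧ T ⊆ h ∧ ¬ S ⊆ h ∧ P ⊆ h} =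
      {h | cs.IsHalf h ∧ T ⊆ h ∧ ¬ S ⊆ h ∧ P' ⊆ h} := by
    ext h
    have := hside h
    simp only [Set.mem_ofPred_eq]
    tauto
  have c2 : {h | cs.IsHalf h ∧ T ⊆ h ∧ ¬ S ⊆ h ∧ ¬ P ⊆ h} =
      {h | cs.IsHalf h ∧ T ⊆ h ∧ ¬ S ⊆ h ∧ ¬ P' ⊆ h} := by
    ext h
    have := hside h
    simp only [Set.mem_ofPred_eq]
    tauto
  rw [c1] at a1
  rw [c2] at a2
  omega

/-- A coset of `W_I` is the intersection of the half-spaces containing it. -/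
theorem exists_half_of_not_mem {I : Set B} {c x : W} (hx : c⁻¹ * x ∉ cs.parabolic I) :
    ∃ h, cs.IsHalf h ∧ {v | c⁻¹ * v ∈ cs.parabolic I} ⊆ h ∧ x ∉ h := by
  obtain ⟨g, hg, hmin⟩ : ∃ g, c⁻¹ * g ∈ cs.parabolic I ∧
      ∀ g', c⁻¹ * g' ∈ cs.parabolic I → cs.length (g⁻¹ * x) ≤ cs.length (g'⁻¹ * x) := by
    have hne : {g | c⁻¹ * g ∈ cs.parabolic I}.Nonempty := ⟨c, by simp⟩
    exact ⟨_, Function.argminOn_mem (fun g => cs.length (g⁻¹ * x)) _ hne, fun g' hg' =>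
      Function.argminOn_le (fun g => cs.length (g⁻¹ * x))
        {g | c⁻¹ * g ∈ cs.parabolic I} hg'⟩
  have hgc : ∀ v, c⁻¹ * v ∈ cs.parabolic I ↔ g⁻¹ * v ∈ cs.parabolic I := by
    intro v
    have e : c⁻¹ * v = (c⁻¹ * g) * (g⁻¹ * v) := by group
    rw [e, Subgroup.mul_mem_cancel_left _ hg]
  have hne : g⁻¹ * x ≠ 1 := by
    intro h
    rw [hgc, h] at hx
    exact hx (one_mem _)
  obtain ⟨i, hi⟩ := cs.exists_leftDescent_of_ne_one hne
  have hi' : cs.simple i ∉ cs.parabolic I := by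
    intro h
    have h1 := hmin (g * cs.simple i) (by rw [← mul_assoc]; exact mul_mem hg h)
    have h2 : cs.length (cs.simple i * (g⁻¹ * x)) < cs.length (g⁻¹ * x) := hi
    rw [mul_inv_rev, cs.inv_simple, mul_assoc] at h1
    omega
  refine ⟨_, isHalf_iff.2 ⟨g, cs.simple i, cs.isReflection_simple i, rfl⟩, ?_, ?_⟩
  · intro v hv hinv
    exact hi' (IsLeftInversion.mem_parabolic ((hgc v).1 hv) hinv)
  · exact fun h => h ((cs.isLeftInversion_simple_iff_isLeftDescent _ i).2 hi)

end CoxeterSystem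

namespace Bldg

variable {cs : CoxeterSystem M W} {X : Bldg cs}

@[simp]
theorem delta_self (C : X.Chamber) : X.delta C C = 1 := (X.delta_eq_one_iff C C).2 rfl

theorem delta_simple_symm {C D : X.Chamber} {i : B} (h : X.delta C D = cs.simple i) :
    X.delta D C = cs.simple i := by
  have hne : cs.simple i ≠ 1 := fun h1 => by
    have := cs.length_simple i
    rw [h1] at this
    simp at this
  rcases X.delta_mem_pair D C D i h with h1 | h1
  · rw [delta_self] at h1
    rw [← mul_one (X.delta D C), ← cs.simple_mul_simple_self i, ← mul_assoc, ← h1, one_mul]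
  · rw [delta_self] at h1
    rw [(X.delta_eq_one_iff D C).1 h1.symm, delta_self] at h
    exact absurd h.symm hne

/-- Every element is reached by its last letter in a reduced word. -/
theorem exists_last_step {C D : X.Chamber} (h : X.delta C D ≠ 1) :
    ∃ E i, X.delta C D = X.delta C E * cs.simple i ∧ X.delta E D = cs.simple i ∧
      X.gdist C D = X.gdist C E + 1 := by
  obtain ⟨i, hi⟩ := cs.exists_rightDescent_of_ne_one h
  obtain ⟨E, h1, h2⟩ := X.exists_delta C D i
  refine ⟨E, i, ?_, delta_simple_symm h1, ?_⟩
  · rw [h2, mul_assoc, cs.simple_mul_simple_self, mul_one]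
  · rw [gdist, gdist, h2]
    exact (cs.isRightDescent_iff.1 hi).symm

theorem delta_mul {C D E : X.Chamber}
    (h : cs.length (X.delta C D * X.delta D E) = X.gdist C D + X.gdist D E) :
    X.delta C E = X.delta C D * X.delta D E := by
  induction hn : X.gdist D E generalizing E with
  | zero =>
    have h1 : X.delta D E = 1 := cs.length_eq_zero_iff.1 hn
    rw [h1, mul_one, (X.delta_eq_one_iff D E).1 h1]
  | succ n ih =>
    have h1 : X.delta D E ≠ 1 := by
      intro h1
      rw [gdist, h1] at hn
      simp at hn
    obtain ⟨E', i, e1, e2, e3⟩ := exists_last_step h1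
    have h2 := cs.length_mul_le (X.delta C D) (X.delta D E')
    have h3 := cs.length_mul_le (X.delta C D * X.delta D E') (cs.simple i)
    rw [e1, ← mul_assoc] at h
    rw [cs.length_simple] at h3
    simp only [gdist] at *
    have h4 := ih (E := E') (by omega) (by omega)
    rw [e1, ← mul_assoc, ← h4]
    refine X.delta_eq_of_length _ _ _ _ e2 ?_
    rw [h4]
    omega

theorem delta_symm (C D : X.Chamber) : X.delta D C = (X.delta C D)⁻¹ := by
  induction hn : X.gdist C D generalizing D with
  | zero =>
    have h1 : X.delta C D = 1 := cs.length_eq_zero_iff.1 hn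
    rw [h1, (X.delta_eq_one_iff C D).1 h1, delta_self, inv_one]
  | succ n ih =>
    have h1 : X.delta C D ≠ 1 := by
      intro h1
      rw [gdist, h1] at hn
      simp at hn
    obtain ⟨E, i, e1, e2, e3⟩ := exists_last_step h1
    have h2 := ih E (by omega)
    have h3 := delta_simple_symm e2
    have h4 : X.delta D C = X.delta D E * X.delta E C := by
      apply delta_mul
      have h5 : X.delta D E * X.delta E C = (X.delta C D)⁻¹ := by
        rw [h3, h2, e1, mul_inv_rev, cs.inv_simple]
      rw [h5, cs.length_inv, gdist, gdist, h2, h3, cs.length_inv, cs.length_simple]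
      simp only [gdist] at e3
      omega
    rw [h4, h3, h2, e1, mul_inv_rev, cs.inv_simple]

theorem gdist_comm (C D : X.Chamber) : X.gdist C D = X.gdist D C := by
  rw [gdist, gdist, delta_symm C D, cs.length_inv]

theorem gdist_eq_zero {C D : X.Chamber} : X.gdist C D = 0 ↔ C = D := by
  rw [gdist, cs.length_eq_zero_iff, X.delta_eq_one_iff]

/-- A weak triangle law for the Weyl distance. -/
theorem exists_delta_eq_mul (C D E : X.Chamber) :
    ∃ v, X.delta C E = X.delta C D * v ∧ cs.length v ≤ X.gdist D E := by
  induction hn : X.gdist D E generalizing E with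
  | zero =>
    refine ⟨1, ?_, by simp⟩
    rw [gdist_eq_zero.1 hn, mul_one]
  | succ n ih =>
    have h1 : X.delta D E ≠ 1 := by
      intro h1
      rw [gdist, h1] at hn
      simp at hn
    obtain ⟨E', i, e1, e2, e3⟩ := exists_last_step h1
    obtain ⟨v, hv, hl⟩ := ih E' (by omega)
    rcases X.delta_mem_pair C E' E i e2 with h | h
    · refine ⟨v * cs.simple i, by rw [h, hv, mul_assoc], ?_⟩
      have := cs.length_mul_le v (cs.simple i)
      rw [cs.length_simple] at this
      omega
    · exact ⟨v, by rw [h, hv], by omega⟩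

theorem delta_inv_mul_mem {I : Set B} (C : X.Chamber) {D E : X.Chamber}
    (h : X.delta D E ∈ cs.parabolic I) : (X.delta C D)⁻¹ * X.delta C E ∈ cs.parabolic I := by
  induction hn : X.gdist D E generalizing E with
  | zero =>
    rw [gdist_eq_zero.1 hn, inv_mul_cancel]
    exact one_mem _
  | succ n ih =>
    have h1 : X.delta D E ≠ 1 := by
      intro h1
      rw [gdist, h1] at hn
      simp at hn
    obtain ⟨i, hi, hl⟩ := CoxeterSystem.exists_mul_simple_lt h h1
    obtain ⟨E', h2, h3⟩ := X.exists_delta D E i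
    have h4 := ih (E := E') (by rw [h3]; exact mul_mem h hi) (by
      simp only [gdist] at *
      rw [h3]
      omega)
    rcases X.delta_mem_pair C E' E i (delta_simple_symm h2) with h5 | h5
    · rw [h5, ← mul_assoc]
      exact mul_mem h4 hi
    · rwa [h5]

theorem mem_residue {I : Set B} {C D : X.Chamber} :
    D ∈ X.residue I C ↔ X.delta C D ∈ cs.parabolic I := Iff.rfl

theorem mem_residue_self (I : Set B) (C : X.Chamber) : C ∈ X.residue I C := by
  rw [mem_residue, delta_self]
  exact one_mem _

theorem residue_eq_of_mem {I : Set B} {C D : X.Chamber} (h : D ∈ X.residue I C) :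
    X.residue I D = X.residue I C := by
  ext E
  rw [mem_residue] at h ⊢
  rw [mem_residue]
  constructor
  · intro h1
    have h2 := delta_inv_mul_mem C h1
    exact (Subgroup.mul_mem_cancel_left _ (inv_mem h)).1 h2
  · intro h1
    have h2 := delta_inv_mul_mem D h1
    rw [delta_symm C D, inv_inv] at h2
    exact (Subgroup.mul_mem_cancel_left _ h).1 h2

theorem delta_mem_of_mem_residue {I : Set B} {C D E : X.Chamber} (hD : D ∈ X.residue I C)
    (hE : E ∈ X.residue I C) : X.delta D E ∈ cs.parabolic I := by
  rw [← residue_eq_of_mem hD] at hE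
  exact hE

theorem exists_mem_residue_delta_eq {I : Set B} (C D : X.Chamber) {u : W}
    (hu : u ∈ cs.parabolic I) : ∃ E ∈ X.residue I D, X.delta C E = X.delta C D * u := by
  refine CoxeterSystem.parabolic_induction (cs := cs)
    (p := fun u => ∃ E ∈ X.residue I D, X.delta C E = X.delta C D * u) hu
    ⟨D, mem_residue_self I D, by simp⟩ ?_
  rintro v i _ hi _ ⟨E, hE, h⟩
  obtain ⟨E', h1, h2⟩ := X.exists_delta C E i
  refine ⟨E', ?_, by rw [h2, h, mul_assoc]⟩
  rw [← residue_eq_of_mem hE, mem_residue, h1]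
  exact hi

/-- `G` is the gate of `C` in `R`. -/
def IsGate (R : Set X.Chamber) (C G : X.Chamber) : Prop :=
  G ∈ R ∧ ∀ E ∈ R, X.gdist C E = X.gdist C G + X.gdist G E

theorem IsGate.eq {R : Set X.Chamber} {C G G' : X.Chamber} (h : IsGate R C G)
    (h' : IsGate R C G') : G = G' := by
  have h1 := h.2 G' h'.1
  have h2 := h'.2 G h.1
  exact gdist_eq_zero.1 (by omega)

theorem IsGate.gate_eq {R : Set X.Chamber} {C G : X.Chamber} (h : IsGate R C G) :
    X.gate R C = G :=
  IsGate.eq (Classical.epsilon_spec (p := fun D => IsGate R C D) ⟨G, h⟩) h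

theorem isGate_of_forall_le {I : Set B} {C G : X.Chamber}
    (h : ∀ u ∈ cs.parabolic I, cs.length (X.delta C G) ≤ cs.length (X.delta C G * u)) :
    IsGate (X.residue I G) C G := by
  refine ⟨mem_residue_self I G, fun E hE => ?_⟩
  have h1 := CoxeterSystem.length_mul_of_forall_le h (mem_residue.1 hE)
  rw [gdist, delta_mul h1, h1]
  rfl

theorem IsGate.forall_le {I : Set B} {C G : X.Chamber} (h : IsGate (X.residue I G) C G) :
    ∀ u ∈ cs.parabolic I, cs.length (X.delta C G) ≤ cs.length (X.delta C G * u) := by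
  intro u hu
  obtain ⟨E, hE, h1⟩ := exists_mem_residue_delta_eq C G hu
  have h2 := h.2 E hE
  rw [← h1]
  simp only [gdist] at h2
  omega

theorem isGate_residue_gate (I : Set B) (D C : X.Chamber) :
    IsGate (X.residue I D) C (X.gate (X.residue I D) C) := by
  have hne : (X.residue I D).Nonempty := ⟨D, mem_residue_self I D⟩
  have hG := Function.argminOn_mem (X.gdist C) (X.residue I D) hne
  have hmin := fun E hE => Function.argminOn_le (X.gdist C) (X.residue I D) (a := E) hE
  set G := Function.argminOn (X.gdist C) (X.residue I D) hne
  have h : IsGate (X.residue I D) C G := by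
    rw [← residue_eq_of_mem hG]
    refine isGate_of_forall_le fun u hu => ?_
    obtain ⟨E, hE, h1⟩ := exists_mem_residue_delta_eq C G hu
    rw [residue_eq_of_mem hG] at hE
    rw [← h1]
    exact hmin E hE
  rw [h.gate_eq]
  exact h

/-- Any partial isometry from `W` to `X` can be extended across a panel. -/
theorem exists_extend {𝒢 : Set (W × X.Chamber)}
    (h𝒢 : ∀ p ∈ 𝒢, ∀ q ∈ 𝒢, X.delta p.2 q.2 = p.1⁻¹ * q.1) {p : W × X.Chamber} (hp : p ∈ 𝒢)
    (i : B) : ∃ E, ∀ q ∈ 𝒢, X.delta E q.2 = (p.1 * cs.simple i)⁻¹ * q.1 := by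
  have long : ∀ E, X.delta p.2 E = cs.simple i → ∀ q ∈ 𝒢,
      cs.length (cs.simple i * (p.1⁻¹ * q.1)) = cs.length (p.1⁻¹ * q.1) + 1 →
      X.delta E q.2 = (p.1 * cs.simple i)⁻¹ * q.1 := by
    intro E hE q hq hl
    have h1 := delta_simple_symm hE
    rw [← h𝒢 p hp q hq] at hl
    rw [delta_mul (D := p.2) (by rw [h1, hl, gdist, gdist, h1, cs.length_simple, add_comm]), h1,
      h𝒢 p hp q hq, mul_inv_rev, cs.inv_simple, mul_assoc]
  by_cases hex : ∃ r ∈ 𝒢, cs.length (cs.simple i * (p.1⁻¹ * r.1)) < cs.length (p.1⁻¹ * r.1)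
  · obtain ⟨r, hr, hrl⟩ := hex
    obtain ⟨E, hE, hEr⟩ := X.exists_delta r.2 p.2 i
    refine ⟨E, fun q hq => ?_⟩
    rcases cs.length_simple_mul (p.1⁻¹ * q.1) i with hl | hl
    · exact long E hE q hq hl
    · have hEr' : X.delta E r.2 = cs.simple i * (p.1⁻¹ * r.1) := by
        rw [delta_symm r.2 E, hEr, h𝒢 r hr p hp]
        simp [mul_assoc]
      rcases X.delta_mem_pair q.2 p.2 E i hE with h | h
      · rw [delta_symm q.2 E, h, h𝒢 q hq p hp]
        simp [mul_assoc]
      · exfalso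
        have h1 : X.delta E q.2 = p.1⁻¹ * q.1 := by
          rw [delta_symm q.2 E, h, h𝒢 q hq p hp]
          simp
        obtain ⟨v, hv, hvl⟩ := exists_delta_eq_mul E r.2 q.2
        rw [h1, hEr'] at hv
        rw [gdist, h𝒢 r hr q hq] at hvl
        set a := p.1⁻¹ * r.1 with ha
        set b := p.1⁻¹ * q.1 with hb
        have e1 : r.1⁻¹ * q.1 = a⁻¹ * b := by rw [ha, hb]; group
        have hs := cs.isReflection_simple i
        have ht : cs.IsReflection (a⁻¹ * cs.simple i * a) := by simpa using hs.conj a⁻¹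
        have e2 : v = (a⁻¹ * cs.simple i * a) * (a⁻¹ * b) := by
          rw [hv]
          simp [mul_assoc]
        rw [e1, e2] at hvl
        have h2 : cs.IsLeftInversion (a⁻¹ * b) (a⁻¹ * cs.simple i * a) :=
          ⟨ht, lt_of_le_of_ne hvl (ht.length_mul_right_ne _)⟩
        have h3 := cs.isLeftInversion_mul_iff (u := a) (v := a⁻¹ * b) hs
        rw [mul_inv_cancel_left] at h3
        have h4 : cs.IsLeftInversion a (cs.simple i) := ⟨hs, hrl⟩
        have h5 : cs.IsLeftInversion b (cs.simple i) := ⟨hs, by omega⟩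
        tauto
  · obtain ⟨E, hE, -⟩ := X.exists_delta p.2 p.2 i
    refine ⟨E, fun q hq => long E hE q hq ?_⟩
    rcases cs.length_simple_mul (p.1⁻¹ * q.1) i with hl | hl
    · exact hl
    · exact absurd ⟨q, hq, by omega⟩ hex

/-- Any two chambers lie in a common apartment. -/
theorem exists_isApartMap (C D : X.Chamber) :
    ∃ α : W → X.Chamber, X.IsApartMap α ∧ α 1 = C ∧ α (X.delta C D) = D := by
  let S : Set (Set (W × X.Chamber)) :=
    {𝒢 | ∀ p ∈ 𝒢, ∀ q ∈ 𝒢, X.delta p.2 q.2 = p.1⁻¹ * q.1}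
  have h0 : ({(1, C), (X.delta C D, D)} : Set (W × X.Chamber)) ∈ S := by
    rintro p (rfl | rfl) q (rfl | rfl)
    · simp
    · simp
    · simp [delta_symm C D]
    · simp
  obtain ⟨𝒢, h𝒢0, hmax⟩ := zorn_subset_nonempty S (fun c hc hchain _ => by
    refine ⟨⋃₀ c, ?_, fun s hs => Set.subset_sUnion_of_mem hs⟩
    rintro p ⟨s, hs, hp⟩ q ⟨t, ht, hq⟩
    rcases hchain.total hs ht with h | h
    · exact hc ht p (h hp) q hq
    · exact hc hs p hp q (h hq)) _ h0
  have h𝒢 : ∀ p ∈ 𝒢, ∀ q ∈ 𝒢, X.delta p.2 q.2 = p.1⁻¹ * q.1 := hmax.prop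
  have hdom : ∀ w, ∃ E, (w, E) ∈ 𝒢 := by
    intro w
    induction w using cs.simple_induction_right with
    | one => exact ⟨C, h𝒢0 (by simp)⟩
    | mul_simple_right w i ih =>
      obtain ⟨E, hE⟩ := ih
      obtain ⟨F, hF⟩ := exists_extend h𝒢 hE i
      have hS : insert (w * cs.simple i, F) 𝒢 ∈ S := by
        rintro p (rfl | hp) q (rfl | hq)
        · simp
        · exact hF q hq
        · rw [delta_symm F p.2, hF p hp]
          simp
        · exact h𝒢 p hp q hq
      exact ⟨F, hmax.le_of_ge hS (Set.subset_insert _ _) (Set.mem_insert _ _)⟩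
  choose α hα using hdom
  have hd : ∀ v w, X.delta (α v) (α w) = v⁻¹ * w := fun v w => h𝒢 _ (hα v) _ (hα w)
  have hval : ∀ w E, (w, E) ∈ 𝒢 → α w = E := fun w E h => by
    have := h𝒢 _ (hα w) _ h
    rw [inv_mul_cancel] at this
    exact (X.delta_eq_one_iff _ _).1 this
  refine ⟨α, ⟨fun v w h => ?_, hd⟩, hval _ _ (h𝒢0 (by simp)), hval _ _ (h𝒢0 (by simp))⟩
  have := hd v w
  rw [h, delta_self] at this
  exact (inv_mul_eq_one.1 this.symm)

end Bldg

namespace CoxeterSystem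

variable {cs : CoxeterSystem M W}

/-- The part of `W_I` occurring as gates of elements of a coset `wW_J`, where `w` is of minimal
length in `W_I w W_J`, lies in the parabolic subgroup `W_I ∩ wW_Jw⁻¹`. -/
theorem mem_parabolic_of_length_add {I J : Set B} {w : W}
    (hw : ∀ u ∈ cs.parabolic I, cs.length w ≤ cs.length (u * w)) {a b : W}
    (ha : a ∈ cs.parabolic I) (hb : b ∈ cs.parabolic J)
    (hl : cs.length (w * b) = cs.length a + cs.length (a⁻¹ * (w * b))) :
    a ∈ cs.parabolic {i | cs.simple i ∈ cs.parabolic I ∧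
      w⁻¹ * cs.simple i * w ∈ cs.parabolic J} := by
  induction hn : cs.length a generalizing a b with
  | zero =>
    rw [cs.length_eq_zero_iff.1 hn]
    exact one_mem _
  | succ n ih =>
    have h1 : a ≠ 1 := by rintro rfl; simp at hn
    obtain ⟨i, hi, hil⟩ := exists_simple_mul_lt ha h1
    have hs := cs.isReflection_simple i
    have e1 : cs.simple i * (w * b) = (cs.simple i * a) * (a⁻¹ * (w * b)) := by
      simp [mul_assoc]
    have h2 := cs.length_mul_le (cs.simple i * a) (a⁻¹ * (w * b))
    rw [← e1] at h2
    have h3 : cs.IsLeftInversion (w * b) (cs.simple i) := ⟨hs, by omega⟩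
    have h4 : ¬ cs.IsLeftInversion w (cs.simple i) := fun h =>
      absurd h.2 (not_lt.mpr (hw _ hi))
    have h5 : cs.IsLeftInversion b (w⁻¹ * cs.simple i * w) := by
      rw [cs.isLeftInversion_mul_iff hs] at h3
      tauto
    have hJ := h5.mem_parabolic hb
    have e2 : w * (w⁻¹ * cs.simple i * w * b) = cs.simple i * (w * b) := by group
    have e3 : (cs.simple i * a)⁻¹ * (cs.simple i * (w * b)) = a⁻¹ * (w * b) := by
      simp [mul_assoc]
    have h6 := ih (a := cs.simple i * a) (b := w⁻¹ * cs.simple i * w * b) (mul_mem hi ha)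
      (mul_mem hJ hb) (by
        rw [e2, e3]
        rcases cs.length_simple_mul (w * b) i with h | h <;> omega) (by omega)
    have h8 : cs.simple i ∈ cs.parabolic
        {i | cs.simple i ∈ cs.parabolic I ∧ w⁻¹ * cs.simple i * w ∈ cs.parabolic J} :=
      Subgroup.subset_closure ⟨i, ⟨hi, hJ⟩, rfl⟩
    have h7 := mul_mem h8 h6
    rwa [cs.simple_mul_simple_cancel_left] at h7

end CoxeterSystem

namespace Bldg

variable {cs : CoxeterSystem M W} {X : Bldg cs}

theorem projSet_residue_eq (I J : Set B) (A A' : X.Chamber) :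
    ∃ K C, cs.parabolic K ≤ cs.parabolic I ∧ C ∈ X.residue I A ∧
      X.projSet (X.residue I A) (X.residue J A') = X.residue K C := by
  obtain ⟨C, hC, D, hD, hmin⟩ : ∃ C ∈ X.residue I A, ∃ D ∈ X.residue J A',
      ∀ C' ∈ X.residue I A, ∀ D' ∈ X.residue J A', X.gdist C D ≤ X.gdist C' D' := by
    have hne : (X.residue I A ×ˢ X.residue J A').Nonempty :=
      ⟨(A, A'), mem_residue_self I A, mem_residue_self J A'⟩
    have h := Function.argminOn_mem (fun p => X.gdist p.1 p.2) _ hne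
    exact ⟨_, h.1, _, h.2, fun C' hC' D' hD' =>
      Function.argminOn_le (fun p => X.gdist p.1 p.2) (X.residue I A ×ˢ X.residue J A')
        (a := (C', D')) ⟨hC', hD'⟩⟩
  rw [← residue_eq_of_mem hC, ← residue_eq_of_mem hD] at hmin ⊢
  set w := X.delta C D with hw
  have hJ : ∀ u ∈ cs.parabolic J, cs.length w ≤ cs.length (w * u) := by
    intro u hu
    obtain ⟨E, hE, h1⟩ := exists_mem_residue_delta_eq C D hu
    rw [← h1]
    exact hmin C (mem_residue_self I C) E hE
  have hI : ∀ u ∈ cs.parabolic I, cs.length w ≤ cs.length (u * w) := by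
    intro u hu
    obtain ⟨E, hE, h1⟩ := exists_mem_residue_delta_eq D C (inv_mem hu)
    have h2 := hmin E hE D (mem_residue_self J D)
    rw [gdist_comm E D, gdist, gdist, h1, delta_symm C D, ← mul_inv_rev, cs.length_inv] at h2
    exact h2
  set K : Set B := {i | cs.simple i ∈ cs.parabolic I ∧ w⁻¹ * cs.simple i * w ∈ cs.parabolic J}
  have hKI : cs.parabolic K ≤ cs.parabolic I := by
    refine (Subgroup.closure_le _).2 ?_
    rintro _ ⟨i, hi, rfl⟩
    exact hi.1
  have hKJ : ∀ u ∈ cs.parabolic K, w⁻¹ * u * w ∈ cs.parabolic J := by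
    have h1 : cs.parabolic K ≤ (cs.parabolic J).comap (MulAut.conj w⁻¹).toMonoidHom := by
      refine (Subgroup.closure_le _).2 ?_
      rintro _ ⟨i, hi, rfl⟩
      simpa using hi.2
    intro u hu
    simpa using h1 hu
  refine ⟨K, C, hKI, mem_residue_self I C, ?_⟩
  ext E
  constructor
  · rintro ⟨D', hD', rfl⟩
    have hg := isGate_residue_gate I C D'
    set E := X.gate (X.residue I C) D'
    have hb : X.delta C D' = w * X.delta D D' :=
      delta_mul (CoxeterSystem.length_mul_of_forall_le hJ hD')
    have hgE : IsGate (X.residue I E) D' E := by rwa [residue_eq_of_mem hg.1]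
    have hCE : C ∈ X.residue I E := by
      rw [residue_eq_of_mem hg.1]
      exact mem_residue_self I C
    have h1 := CoxeterSystem.length_mul_of_forall_le hgE.forall_le (mem_residue.1 hCE)
    have h2 : X.delta D' C = X.delta D' E * X.delta E C := delta_mul h1
    rw [← h2, delta_symm C D', delta_symm E D', delta_symm C E, cs.length_inv, cs.length_inv,
      cs.length_inv, hb] at h1
    rw [delta_symm C D', delta_symm E D', delta_symm C E, ← mul_inv_rev, inv_inj, hb] at h2
    refine CoxeterSystem.mem_parabolic_of_length_add hI (mem_residue.1 hg.1) (mem_residue.1 hD') ?_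
    rw [h1, h2, inv_mul_cancel_left, add_comm]
  · intro hE
    have hu := mem_residue.1 hE
    set u := X.delta C E with hu'
    have hEI : E ∈ X.residue I C := hKI hu
    have h1 : X.delta E D = u⁻¹ * w := by
      have h2 := CoxeterSystem.length_mul_of_forall_le_left hI (inv_mem (hKI hu))
      rw [delta_mul (D := C), delta_symm C E]
      rw [gdist, gdist, delta_symm C E]
      exact h2
    obtain ⟨D', hD', h2⟩ := exists_mem_residue_delta_eq E D (hKJ u hu)
    have h3 : X.delta E D' = w := by rw [h2, h1]; group
    refine ⟨D', hD', IsGate.gate_eq ?_⟩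
    rw [← residue_eq_of_mem hEI]
    refine isGate_of_forall_le fun v hv => ?_
    rw [delta_symm E D', h3, ← cs.length_inv (w⁻¹ * v), cs.length_inv, mul_inv_rev, inv_inv]
    exact hI _ (inv_mem hv)

theorem IsSphResidue.exists_eq {R : Set X.Chamber} (hR : X.IsSphResidue R) {C : X.Chamber}
    (hC : C ∈ R) : ∃ I, SphType cs I ∧ R = X.residue I C := by
  obtain ⟨I, D, hI, rfl⟩ := hR
  exact ⟨I, hI, (residue_eq_of_mem hC).symm⟩

theorem IsSphResidue.nonempty {R : Set X.Chamber} (hR : X.IsSphResidue R) : R.Nonempty := by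
  obtain ⟨I, D, hI, rfl⟩ := hR
  exact ⟨D, mem_residue_self I D⟩

theorem IsSphResidue.isGate {R : Set X.Chamber} (hR : X.IsSphResidue R) (C : X.Chamber) :
    IsGate R C (X.gate R C) := by
  obtain ⟨I, D, hI, rfl⟩ := hR
  exact isGate_residue_gate I D C

theorem IsSphResidue.projSet {R T : Set X.Chamber} (hR : X.IsSphResidue R)
    (hT : X.IsSphResidue T) : X.IsSphResidue (X.projSet R T) := by
  obtain ⟨I, A, hI, rfl⟩ := hR
  obtain ⟨J, A', hJ, rfl⟩ := hT
  obtain ⟨K, C, hK, -, h⟩ := projSet_residue_eq I J A A'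
  exact ⟨K, C, Set.Finite.subset hI hK, h⟩

theorem projRes_val (R T : X.Res) : (X.projRes R T).1 = X.projSet R.1 T.1 :=
  Classical.epsilon_spec (p := fun U : X.Res => U.1 = X.projSet R.1 T.1)
    ⟨⟨_, R.2.projSet T.2⟩, rfl⟩

theorem projRes_subset (R T : X.Res) : (X.projRes R T).1 ⊆ R.1 := by
  rw [projRes_val]
  rintro _ ⟨C, _, rfl⟩
  exact (R.2.isGate C).1

theorem sphType_empty : SphType cs (∅ : Set B) := by simp [SphType]

theorem sphType_singleton (i : B) : SphType cs {i} := by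
  have h : ((cs.parabolic {i} : Subgroup W) : Set W) ⊆ {1, cs.simple i} := by
    intro u hu
    induction hu using Subgroup.closure_induction with
    | mem x hx => exact Or.inr (by simpa using hx)
    | one => simp
    | mul x y _ _ hx hy =>
      rcases hx with rfl | rfl <;> rcases hy with rfl | rfl <;> simp
    | inv x _ hx =>
      rcases hx with rfl | rfl <;> simp
  exact (Set.toFinite _).subset h

theorem IsPanel.isSphResidue {R : Set X.Chamber} (hR : X.IsPanel R) : X.IsSphResidue R := by
  obtain ⟨i, C, rfl⟩ := hR
  exact ⟨{i}, C, sphType_singleton i, rfl⟩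

theorem mem_panel {C D : X.Chamber} {i : B} (h : X.delta C D = cs.simple i) :
    D ∈ X.residue {i} C := by
  rw [mem_residue, h]
  exact Subgroup.subset_closure ⟨i, rfl, rfl⟩

theorem finite_sphere (hlf : X.LocallyFinite) (C : X.Chamber) (w : W) :
    {D | X.delta C D = w}.Finite := by
  induction hn : cs.length w generalizing w with
  | zero =>
    refine (Set.finite_singleton C).subset fun D hD => ?_
    have h1 : X.delta C D = 1 := by
      rw [show X.delta C D = w from hD, cs.length_eq_zero_iff.1 hn]
    exact ((X.delta_eq_one_iff C D).1 h1).symm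
  | succ n ih =>
    obtain ⟨i, hi⟩ := cs.exists_rightDescent_of_ne_one (w := w) (by rintro rfl; simp at hn)
    have hi' := cs.isRightDescent_iff.1 hi
    refine ((ih (w * cs.simple i) (by omega)).biUnion
      fun E _ => hlf.2 (X.residue {i} E) ⟨i, E, rfl⟩).subset fun D hD => ?_
    obtain ⟨E, h1, h2⟩ := X.exists_delta C D i
    rw [show X.delta C D = w from hD] at h2
    exact Set.mem_biUnion h2 (mem_panel (delta_simple_symm h1))

theorem IsSphResidue.finite {R : Set X.Chamber} (hR : X.IsSphResidue R) (hlf : X.LocallyFinite) :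
    R.Finite := by
  obtain ⟨I, C, hI, rfl⟩ := hR
  exact (hI.biUnion fun w _ => finite_sphere hlf C w).subset fun D hD => Set.mem_biUnion hD rfl

theorem finite_star (hlf : X.LocallyFinite) (σ : X.Res) : (X.star σ).Finite := by
  refine Set.Finite.of_finite_image (f := fun R : X.Res => R.1) ?_
    (fun R _ T _ h => Subtype.ext h)
  refine (σ.2.finite hlf).finite_subsets.subset ?_
  rintro _ ⟨R, hR, rfl⟩
  exact hR

namespace IsApartMap

variable {α : W → X.Chamber} (hα : X.IsApartMap α)
include hα

theorem comp_mul (u : W) : X.IsApartMap fun v => α (u * v) := by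
  refine ⟨fun v w h => mul_left_cancel (hα.1 h), fun v w => ?_⟩
  rw [hα.2]
  group

theorem exists_eq_comp_mul {β : W → X.Chamber} (hβ : X.IsApartMap β)
    (h : Set.range β ⊆ Set.range α) : ∃ u, ∀ v, β v = α (u * v) := by
  obtain ⟨u, hu⟩ := h ⟨1, rfl⟩
  refine ⟨u, fun v => ?_⟩
  obtain ⟨x, hx⟩ := h ⟨v, rfl⟩
  have h1 := hβ.2 1 v
  rw [← hu, ← hx, hα.2, inv_one, one_mul] at h1
  rw [← hx, ← h1, mul_inv_cancel_left]

theorem isRootOf_iff {φ : Set X.Chamber} :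
    X.IsRootOf (Set.range α) φ ↔ ∃ h, cs.IsHalf h ∧ φ = α '' h := by
  constructor
  · rintro ⟨β, hβ, hr, t, ht, rfl⟩
    obtain ⟨u, hu⟩ := hα.exists_eq_comp_mul hβ hr.ge
    refine ⟨_, ⟨u, t, ht, rfl⟩, ?_⟩
    ext C
    constructor
    · rintro ⟨v, hv, rfl⟩
      refine ⟨u * v, ?_, (hu v).symm⟩
      simpa using hv
    · rintro ⟨v, hv, rfl⟩
      exact ⟨u⁻¹ * v, hv, by rw [hu, mul_inv_cancel_left]⟩
  · rintro ⟨_, ⟨u, t, ht, rfl⟩, rfl⟩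
    refine ⟨_, hα.comp_mul u, ?_, t, ht, ?_⟩
    · ext C
      constructor
      · rintro ⟨v, rfl⟩
        exact ⟨u⁻¹ * v, by simp⟩
      · rintro ⟨v, rfl⟩
        exact ⟨u * v, rfl⟩
    · ext C
      constructor
      · rintro ⟨v, hv, rfl⟩
        exact ⟨u⁻¹ * v, hv, by simp⟩
      · rintro ⟨v, hv, rfl⟩
        refine ⟨u * v, ?_, rfl⟩
        simpa using hv

theorem containedInRoot_iff (R : X.Res) (h : Set W) :
    X.ContainedInRoot R (Set.range α) (α '' h) ↔ α ⁻¹' R.1 ⊆ h := by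
  constructor
  · intro H v hv
    obtain ⟨x, hx, e⟩ := H ⟨hv, v, rfl⟩
    rwa [← hα.1 e]
  · rintro H _ ⟨hC, v, rfl⟩
    exact ⟨v, H hC, rfl⟩

theorem ncard_phiSep (R₁ R₂ : X.Res) :
    (X.PhiSep (Set.range α) R₁ R₂).ncard = (cs.halfSep (α ⁻¹' R₁.1) (α ⁻¹' R₂.1)).ncard := by
  have e : X.PhiSep (Set.range α) R₁ R₂ =
      (fun h => α '' h) '' cs.halfSep (α ⁻¹' R₁.1) (α ⁻¹' R₂.1) := by
    ext φ
    constructor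
    · rintro ⟨h1, h2, h3⟩
      obtain ⟨h, hh, rfl⟩ := hα.isRootOf_iff.1 h1
      rw [hα.containedInRoot_iff] at h2 h3
      exact ⟨h, ⟨hh, h2, h3⟩, rfl⟩
    · rintro ⟨h, ⟨hh, h2, h3⟩, rfl⟩
      refine ⟨hα.isRootOf_iff.2 ⟨h, hh, rfl⟩, ?_, ?_⟩
      · exact (hα.containedInRoot_iff R₁ h).2 h2
      · exact fun H => h3 ((hα.containedInRoot_iff R₂ h).1 H)
  rw [e, Set.ncard_image_of_injective _ hα.1.image_injective]

theorem preimage_residue (I : Set B) (c : W) :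
    α ⁻¹' X.residue I (α c) = {v | c⁻¹ * v ∈ cs.parabolic I} := by
  ext v
  rw [Set.mem_preimage, mem_residue, hα.2]
  rfl

theorem preimage_finite (R : X.Res) : (α ⁻¹' R.1).Finite := by
  rcases (α ⁻¹' R.1).eq_empty_or_nonempty with h | ⟨c, hc⟩
  · rw [h]; exact Set.finite_empty
  · obtain ⟨I, hI, e⟩ := R.2.exists_eq hc
    rw [e, hα.preimage_residue]
    exact hI.preimage (mul_right_injective c⁻¹).injOn

/-- Two apartments meeting both residues differ by a translation on these residues. -/
theorem exists_preimage_eq {β : W → X.Chamber} (hβ : X.IsApartMap β) {R₁ R₂ : X.Res}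
    (h₁ : (α ⁻¹' R₁.1).Nonempty) (h₂ : (α ⁻¹' R₂.1).Nonempty) (h₁' : (β ⁻¹' R₁.1).Nonempty)
    (h₂' : (β ⁻¹' R₂.1).Nonempty) :
    ∃ u, α ⁻¹' R₁.1 = (fun x => u * x) ⁻¹' (β ⁻¹' R₁.1) ∧
      α ⁻¹' R₂.1 = (fun x => u * x) ⁻¹' (β ⁻¹' R₂.1) := by
  obtain ⟨c, hc⟩ := h₁
  obtain ⟨d, hd⟩ := h₂
  obtain ⟨c', hc'⟩ := h₁'
  obtain ⟨d', hd'⟩ := h₂'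
  obtain ⟨I, -, e₁⟩ := R₁.2.exists_eq hc
  obtain ⟨J, -, e₂⟩ := R₂.2.exists_eq hd
  have e₁' : R₁.1 = X.residue I (β c') := by
    have h : β c' ∈ R₁.1 := hc'
    rw [e₁] at h
    rw [residue_eq_of_mem h, e₁]
  have e₂' : R₂.1 = X.residue J (β d') := by
    have h : β d' ∈ R₂.1 := hd'
    rw [e₂] at h
    rw [residue_eq_of_mem h, e₂]
  have ha : (X.delta (α d) (α c))⁻¹ * X.delta (α d) (β c') ∈ cs.parabolic I := by
    refine delta_inv_mul_mem _ ?_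
    have h : β c' ∈ R₁.1 := hc'
    rwa [e₁] at h
  have hb : (X.delta (β c') (α d))⁻¹ * X.delta (β c') (β d') ∈ cs.parabolic J := by
    refine delta_inv_mul_mem _ ?_
    have h : β d' ∈ R₂.1 := hd'
    rwa [e₂] at h
  rw [delta_symm (β c') (α d), hα.2, hβ.2] at *
  set y := X.delta (β c') (α d)
  refine ⟨c' * (y * (d⁻¹ * c)) * c⁻¹, ?_, ?_⟩
  · rw [show α ⁻¹' R₁.1 = {v | c⁻¹ * v ∈ cs.parabolic I} by rw [e₁, hα.preimage_residue],
      show β ⁻¹' R₁.1 = {v | c'⁻¹ * v ∈ cs.parabolic I} by rw [e₁', hβ.preimage_residue]]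
    ext v
    simp only [Set.mem_preimage, Set.mem_ofPred_eq]
    have h1 : (y * (d⁻¹ * c)) ∈ cs.parabolic I := by
      have := inv_mem ha
      simpa [mul_assoc] using this
    have h2 : c'⁻¹ * (c' * (y * (d⁻¹ * c)) * c⁻¹ * v) = (y * (d⁻¹ * c)) * (c⁻¹ * v) := by group
    rw [h2, Subgroup.mul_mem_cancel_left _ h1]
  · rw [show α ⁻¹' R₂.1 = {v | d⁻¹ * v ∈ cs.parabolic J} by rw [e₂, hα.preimage_residue],
      show β ⁻¹' R₂.1 = {v | d'⁻¹ * v ∈ cs.parabolic J} by rw [e₂', hβ.preimage_residue]]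
    ext v
    simp only [Set.mem_preimage, Set.mem_ofPred_eq]
    have h2 : d'⁻¹ * (c' * (y * (d⁻¹ * c)) * c⁻¹ * v) = (y⁻¹ * (c'⁻¹ * d'))⁻¹ * (d⁻¹ * v) := by
      group
    rw [h2, Subgroup.mul_mem_cancel_left _ (inv_mem hb)]

end IsApartMap

theorem exists_isApartMap_nonempty (R₁ R₂ : X.Res) :
    ∃ α, X.IsApartMap α ∧ (α ⁻¹' R₁.1).Nonempty ∧ (α ⁻¹' R₂.1).Nonempty := by
  obtain ⟨C, hC⟩ := R₁.2.nonempty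
  obtain ⟨D, hD⟩ := R₂.2.nonempty
  obtain ⟨α, hα, h1, h2⟩ := exists_isApartMap C D
  exact ⟨α, hα, ⟨1, by rwa [Set.mem_preimage, h1]⟩, ⟨_, by rwa [Set.mem_preimage, h2]⟩⟩

/-- The root-distance may be computed in any apartment containing both residues. -/
theorem rootDist_eq {α : W → X.Chamber} (hα : X.IsApartMap α) {R₁ R₂ : X.Res}
    (h₁ : (α ⁻¹' R₁.1).Nonempty) (h₂ : (α ⁻¹' R₂.1).Nonempty) :
    X.rootDist R₁ R₂ = (((cs.halfSep (α ⁻¹' R₁.1) (α ⁻¹' R₂.1)).ncard +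
      (cs.halfSep (α ⁻¹' R₂.1) (α ⁻¹' R₁.1)).ncard : ℕ) : ℝ) / 2 := by
  have hspec : X.IsApartment (X.chooseApt R₁ R₂) ∧ X.LiesIn R₁ (X.chooseApt R₁ R₂) ∧
      X.LiesIn R₂ (X.chooseApt R₁ R₂) := by
    refine Classical.epsilon_spec (p := fun A : Set X.Chamber =>
      X.IsApartment A ∧ X.LiesIn R₁ A ∧ X.LiesIn R₂ A) ⟨Set.range α, ⟨α, hα, rfl⟩, ?_, ?_⟩
    · obtain ⟨v, hv⟩ := h₁
      exact ⟨α v, hv, v, rfl⟩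
    · obtain ⟨v, hv⟩ := h₂
      exact ⟨α v, hv, v, rfl⟩
  obtain ⟨⟨β, hβ, e⟩, hl₁, hl₂⟩ := hspec
  rw [rootDist, e, hβ.ncard_phiSep, hβ.ncard_phiSep]
  rw [e] at hl₁ hl₂
  obtain ⟨_, hc, c, rfl⟩ := hl₁
  obtain ⟨_, hd, d, rfl⟩ := hl₂
  obtain ⟨u, e₁, e₂⟩ := hα.exists_preimage_eq hβ h₁ h₂ ⟨c, hc⟩ ⟨d, hd⟩
  rw [e₁, e₂, CoxeterSystem.ncard_halfSep_preimage, CoxeterSystem.ncard_halfSep_preimage]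

end Bldg

namespace Bldg

variable {cs : CoxeterSystem M W} {X : Bldg cs}

theorem IsSphResidue.gate_mem {R : Set X.Chamber} (hR : X.IsSphResidue R) (C : X.Chamber) :
    X.gate R C ∈ R := (hR.isGate C).1

namespace IsApartMap

variable {α : W → X.Chamber} (hα : X.IsApartMap α)
include hα

theorem exists_gate_eq {σ : X.Res} (hσ : (α ⁻¹' σ.1).Nonempty) (x : W) :
    ∃ g, X.gate σ.1 (α x) = α g := by
  have hg := Function.argminOn_mem (fun g => cs.length (x⁻¹ * g)) _ hσ
  have hmin := fun g hg =>
    Function.argminOn_le (fun g => cs.length (x⁻¹ * g)) (α ⁻¹' σ.1) (a := g) hg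
  set g := Function.argminOn (fun g => cs.length (x⁻¹ * g)) (α ⁻¹' σ.1) hσ
  obtain ⟨J, -, e⟩ := σ.2.exists_eq hg
  refine ⟨g, IsGate.gate_eq ?_⟩
  rw [e]
  refine isGate_of_forall_le fun u hu => ?_
  rw [hα.2, mul_assoc]
  refine hmin (g * u) ?_
  rw [e, hα.preimage_residue]
  simpa using hu

/-- A half-space cutting a residue contains a chamber exactly if it contains its gate. -/
theorem mem_half_iff_gate {σ : X.Res} {h : Set W} (hh : cs.IsHalf h)
    (h₁ : (α ⁻¹' σ.1 ∩ h).Nonempty) (h₂ : ¬ α ⁻¹' σ.1 ⊆ h) {x g : W}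
    (hg : X.gate σ.1 (α x) = α g) : x ∈ h ↔ g ∈ h := by
  have hG := σ.2.isGate (α x)
  rw [hg] at hG
  have hl : ∀ y ∈ α ⁻¹' σ.1, cs.length (x⁻¹ * y) = cs.length (x⁻¹ * g) + cs.length (g⁻¹ * y) := by
    intro y hy
    have h3 := hG.2 (α y) hy
    simpa only [gdist, hα.2] using h3
  obtain ⟨y, hy, hyh⟩ := h₁
  obtain ⟨z, hz, hzh⟩ := Set.not_subset.1 h₂
  constructor
  · exact fun hx => hh.mem_of_length_eq hx hyh (hl y hy)
  · intro hgh
    by_contra hx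
    exact hh.compl.mem_of_length_eq hx hzh (hl z hz) hgh

theorem mem_preimage_projRes {σ R : X.Res} (hR : (α ⁻¹' R.1).Nonempty) {v : W} :
    v ∈ α ⁻¹' (X.projRes σ R).1 ↔ ∃ x ∈ α ⁻¹' R.1, X.gate σ.1 (α x) = α v := by
  rw [projRes_val]
  constructor
  · rintro ⟨D, hD, hv⟩
    obtain ⟨x₀, hx₀⟩ := hR
    obtain ⟨I, -, e⟩ := R.2.exists_eq hx₀
    have hvσ : α v ∈ σ.1 := hv ▸ σ.2.gate_mem D
    obtain ⟨J, -, e'⟩ := σ.2.exists_eq hvσ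
    refine ⟨v * X.delta (α v) D, ?_, IsGate.gate_eq ?_⟩
    · rw [e, hα.preimage_residue]
      have h1 := delta_inv_mul_mem (α v) (delta_mem_of_mem_residue (e ▸ hD) (e ▸ hx₀))
      rw [hα.2] at h1
      have h2 := inv_mem h1
      simpa [mul_assoc] using h2
    · have h1 := σ.2.isGate D
      rw [hv, e'] at h1
      rw [e']
      refine isGate_of_forall_le ?_
      have h2 := h1.forall_le
      rw [delta_symm (α v) D] at h2
      rwa [hα.2, mul_inv_rev, inv_mul_cancel_right]
  · rintro ⟨x, hx, e⟩
    exact ⟨α x, hx, e⟩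

theorem preimage_projRes_nonempty {σ R : X.Res} (hσ : (α ⁻¹' σ.1).Nonempty)
    (hR : (α ⁻¹' R.1).Nonempty) : (α ⁻¹' (X.projRes σ R).1).Nonempty := by
  obtain ⟨x, hx⟩ := id hR
  obtain ⟨g, hg⟩ := hα.exists_gate_eq hσ x
  exact ⟨g, (hα.mem_preimage_projRes hR).2 ⟨x, hx, hg⟩⟩

theorem subset_half_iff_projRes {σ R : X.Res} {h : Set W} (hh : cs.IsHalf h)
    (h₁ : (α ⁻¹' σ.1 ∩ h).Nonempty) (h₂ : ¬ α ⁻¹' σ.1 ⊆ h) (hR : (α ⁻¹' R.1).Nonempty) :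
    α ⁻¹' R.1 ⊆ h ↔ α ⁻¹' (X.projRes σ R).1 ⊆ h := by
  constructor
  · intro H v hv
    obtain ⟨x, hx, e⟩ := (hα.mem_preimage_projRes hR).1 hv
    exact (hα.mem_half_iff_gate hh h₁ h₂ e).1 (H hx)
  · intro H x hx
    obtain ⟨g, hg⟩ := hα.exists_gate_eq (h₁.mono Set.inter_subset_left) x
    exact (hα.mem_half_iff_gate hh h₁ h₂ hg).2 (H ((hα.mem_preimage_projRes hR).2 ⟨x, hx, hg⟩))

end IsApartMap

/-- On the star of a residue `σ`, root-distances from `R` and from its projection differ by a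
constant. -/
theorem rootDist_sub_rootDist {R σ τ : X.Res} (h : X.leRes σ τ) :
    X.rootDist R τ - X.rootDist R σ =
      X.rootDist (X.projRes σ R) τ - X.rootDist (X.projRes σ R) σ := by
  obtain ⟨α, hα, hR, hτ⟩ := exists_isApartMap_nonempty R τ
  have hτσ : α ⁻¹' τ.1 ⊆ α ⁻¹' σ.1 := Set.preimage_mono h
  have hσ := hτ.mono hτσ
  have hp := hα.preimage_projRes_nonempty hσ hR
  rw [rootDist_eq hα hR hτ, rootDist_eq hα hR hσ, rootDist_eq hα hp hτ, rootDist_eq hα hp hσ]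
  have key := CoxeterSystem.ncard_halfSep_add_eq (cs := cs) hτσ hR hp hτ (hα.preimage_finite R)
    (hα.preimage_finite _) (hα.preimage_finite σ) (fun k hk h1 h2 =>
      hα.subset_half_iff_projRes hk (hτ.mono (Set.subset_inter hτσ h1)) h2 hR)
  have key' := congrArg (Nat.cast : ℕ → ℝ) key
  push_cast at key' ⊢
  linarith

theorem rootDist_nonneg (R T : X.Res) : 0 ≤ X.rootDist R T := by
  unfold rootDist
  positivity

theorem rootDist_self (R : X.Res) : X.rootDist R R = 0 := by
  obtain ⟨α, hα, hR, -⟩ := exists_isApartMap_nonempty R R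
  rw [rootDist_eq hα hR hR]
  have h : cs.halfSep (α ⁻¹' R.1) (α ⁻¹' R.1) = ∅ :=
    Set.eq_empty_of_forall_notMem fun h hh => hh.2.2 hh.2.1
  simp [h]

theorem IsApartMap.preimage_subset_of_halfSep_eq_empty {α : W → X.Chamber} (hα : X.IsApartMap α)
    {R T : X.Res} (hR : (α ⁻¹' R.1).Nonempty)
    (h : cs.halfSep (α ⁻¹' R.1) (α ⁻¹' T.1) = ∅) : α ⁻¹' T.1 ⊆ α ⁻¹' R.1 := by
  intro x hx
  by_contra hxR
  obtain ⟨c, hc⟩ := hR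
  obtain ⟨I, -, e⟩ := R.2.exists_eq hc
  have e' := hα.preimage_residue I c
  rw [← e] at e'
  rw [e'] at hxR h
  obtain ⟨k, hk, h1, h2⟩ := CoxeterSystem.exists_half_of_not_mem hxR
  have h3 : k ∈ cs.halfSep {v | c⁻¹ * v ∈ cs.parabolic I} (α ⁻¹' T.1) :=
    ⟨hk, h1, fun h3 => h2 (h3 hx)⟩
  rw [h] at h3
  exact h3

theorem eq_of_rootDist_eq_zero {R T : X.Res} (h : X.rootDist R T = 0) : R = T := by
  obtain ⟨α, hα, hR, hT⟩ := exists_isApartMap_nonempty R T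
  rw [rootDist_eq hα hR hT, div_eq_zero_iff, or_iff_left two_ne_zero, Nat.cast_eq_zero,
    Nat.add_eq_zero_iff, Set.ncard_eq_zero (CoxeterSystem.finite_halfSep hR (hα.preimage_finite T)),
    Set.ncard_eq_zero (CoxeterSystem.finite_halfSep hT (hα.preimage_finite R))] at h
  have hRT : α ⁻¹' R.1 = α ⁻¹' T.1 :=
    (hα.preimage_subset_of_halfSep_eq_empty hT h.2).antisymm
      (hα.preimage_subset_of_halfSep_eq_empty hR h.1)
  obtain ⟨c, hc⟩ := hR
  have hc' := hRT ▸ hc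
  obtain ⟨I, -, e⟩ := R.2.exists_eq hc
  obtain ⟨J, -, e'⟩ := T.2.exists_eq hc'
  rw [e, e', hα.preimage_residue, hα.preimage_residue] at hRT
  have hP : cs.parabolic I = cs.parabolic J := by
    ext u
    have h1 := Set.ext_iff.1 hRT (c * u)
    simpa using h1
  refine Subtype.ext ?_
  rw [e, e']
  ext D
  rw [mem_residue, mem_residue, hP]

/-- Root-distances on the star of `σ` determine the projection to `σ`. -/
theorem projRes_eq_of_rootDist {R R' σ : X.Res} (h : ∀ τ ∈ X.star σ,
    X.rootDist R τ - X.rootDist R σ = X.rootDist R' τ - X.rootDist R' σ) :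
    X.projRes σ R = X.projRes σ R' := by
  have h1 := h _ (projRes_subset σ R)
  have h2 := h _ (projRes_subset σ R')
  rw [rootDist_sub_rootDist (projRes_subset σ R),
    rootDist_sub_rootDist (R := R') (projRes_subset σ R), rootDist_self] at h1
  rw [rootDist_sub_rootDist (projRes_subset σ R'),
    rootDist_sub_rootDist (R := R') (projRes_subset σ R'), rootDist_self] at h2
  refine eq_of_rootDist_eq_zero ?_
  linarith [rootDist_nonneg (X.projRes σ R) (X.projRes σ R'),
    rootDist_nonneg (X.projRes σ R') (X.projRes σ R)]

section Equivariance

variable (g : X.Aut)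

theorem delta_apply (C D : X.Chamber) : X.delta (g.1 C) (g.1 D) = X.delta C D := g.2 C D

theorem image_residue (I : Set B) (C : X.Chamber) :
    g.1 '' X.residue I C = X.residue I (g.1 C) := by
  ext D
  constructor
  · rintro ⟨E, hE, rfl⟩
    rwa [mem_residue, delta_apply]
  · intro hD
    obtain ⟨E, rfl⟩ := g.1.surjective D
    rw [mem_residue, delta_apply] at hD
    exact ⟨E, hD, rfl⟩

theorem actRes_val (R : X.Res) : (X.actRes g R).1 = g.1 '' R.1 := by
  refine Classical.epsilon_spec (p := fun T : X.Res => T.1 = g.1 '' R.1) ?_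
  obtain ⟨I, C, hI, e⟩ := R.2
  exact ⟨⟨_, I, g.1 C, hI, rfl⟩, by rw [e, image_residue]⟩

theorem actPanel_val (σ : X.Panel) : (X.actPanel g σ).1 = g.1 '' σ.1 := by
  have : Nonempty X.Panel := ⟨σ⟩
  refine Classical.epsilon_spec (p := fun T : X.Panel => T.1 = g.1 '' σ.1) ?_
  obtain ⟨i, C, e⟩ := σ.2
  exact ⟨⟨_, i, g.1 C, rfl⟩, by rw [e, image_residue]⟩

theorem apply_inv_apply (C : X.Chamber) : g.1 ((g⁻¹ : X.Aut).1 C) = C := by simp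

theorem actRes_actRes_inv (R : X.Res) : X.actRes g (X.actRes g⁻¹ R) = R := by
  refine Subtype.ext ?_
  rw [actRes_val, actRes_val, Set.image_image]
  simp only [apply_inv_apply, Set.image_id']

theorem actPanel_actPanel_inv (R : X.Panel) : X.actPanel g (X.actPanel g⁻¹ R) = R := by
  refine Subtype.ext ?_
  rw [actPanel_val, actPanel_val, Set.image_image]
  simp only [apply_inv_apply, Set.image_id']

theorem gdist_apply (C D : X.Chamber) : X.gdist (g.1 C) (g.1 D) = X.gdist C D := by
  rw [gdist, delta_apply, gdist]

theorem gdist_inv_apply (C D : X.Chamber) :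
    X.gdist C ((g⁻¹ : X.Aut).1 D) = X.gdist (g.1 C) D := by
  rw [← gdist_apply g, apply_inv_apply]

theorem gate_image {R : Set X.Chamber} (hR : X.IsSphResidue R) (C : X.Chamber) :
    X.gate (g.1 '' R) (g.1 C) = g.1 (X.gate R C) := by
  refine IsGate.gate_eq ⟨⟨_, hR.gate_mem C, rfl⟩, ?_⟩
  rintro _ ⟨E, hE, rfl⟩
  rw [gdist_apply, gdist_apply, gdist_apply]
  exact (hR.isGate C).2 E hE

theorem projRes_actRes (σ R : X.Res) :
    X.projRes (X.actRes g σ) (X.actRes g R) = X.actRes g (X.projRes σ R) := by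
  refine Subtype.ext ?_
  rw [projRes_val, actRes_val, actRes_val, actRes_val, projRes_val, projSet, projSet,
    Set.image_image, Set.image_image]
  simp only [gate_image g σ.2]

theorem actCr_projr (R : X.Res) : X.actCr g (X.projr R) = X.projr (X.actRes g R) := by
  funext σ
  rw [actCr, projr, projr, ← projRes_actRes, actRes_actRes_inv]

theorem actCc_projc (C : X.Chamber) : X.actCc g (X.projc C) = X.projc (g.1 C) := by
  funext σ
  rw [actCc, projc, projc, ← gate_image g (X.actPanel g⁻¹ σ).2.isSphResidue, ← actPanel_val,
    actPanel_actPanel_inv]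

theorem rootDist_actRes (R T : X.Res) :
    X.rootDist (X.actRes g R) (X.actRes g T) = X.rootDist R T := by
  obtain ⟨α, hα, hR, hT⟩ := exists_isApartMap_nonempty R T
  have hβ : X.IsApartMap fun v => g.1 (α v) :=
    ⟨fun v w h => hα.1 (g.1.injective h), fun v w => by rw [delta_apply, hα.2]⟩
  have e : ∀ Q : X.Res, (fun v => g.1 (α v)) ⁻¹' (X.actRes g Q).1 = α ⁻¹' Q.1 := by
    intro Q
    rw [actRes_val]
    ext v
    exact g.1.injective.mem_set_image
  rw [rootDist_eq hα hR hT, rootDist_eq hβ (by rwa [e]) (by rwa [e]), e, e]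

theorem rootDist_actRes_inv (R T : X.Res) :
    X.rootDist R (X.actRes g⁻¹ T) = X.rootDist (X.actRes g R) T := by
  rw [← rootDist_actRes g, actRes_actRes_inv]

end Equivariance

end Bldg

theorem exists_forall_eq_of_mem_closure_range {Z ι K : Type*} [TopologicalSpace K]
    [DiscreteTopology K] {p : Z → ι → K} {ξ : ι → K} (hξ : ξ ∈ closure (Set.range p))
    {I : Set ι} (hI : I.Finite) : ∃ z, ∀ i ∈ I, p z i = ξ i := by
  obtain ⟨_, h, z, rfl⟩ := mem_closure_iff.1 hξ (I.pi fun i => {ξ i})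
    (isOpen_set_pi hI fun _ _ => isOpen_discrete _) (fun _ _ => rfl)
  exact ⟨z, h⟩

theorem comap_nhds_neBot {Z T : Type*} [TopologicalSpace T] {p : Z → T} {ξ : T}
    (hξ : ξ ∈ closure (Set.range p)) : (comap p (𝓝 ξ)).NeBot := by
  refine comap_neBot fun t ht => ?_
  obtain ⟨_, h, z, rfl⟩ := mem_closure_iff_nhds.1 hξ t ht
  exact ⟨z, h⟩

/-- Two compactifications of a set `Z`, one by maps `p z` to finite sets and the other by
real-valued functions `f z`, agree if the coordinates of either one depend only on finitely many
coordinates of the other one. -/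
theorem exists_homeomorph_closure_range {Z ι K Y : Type*} [TopologicalSpace K]
    [DiscreteTopology K] (p : Z → ι → K) (f : Z → Y → ℝ)
    (hfin : ∀ i, ∃ s : Set K, s.Finite ∧ ∀ z, p z i ∈ s)
    (hf : ∀ y, ∃ I : Set ι, I.Finite ∧ ∀ z z', (∀ i ∈ I, p z i = p z' i) → f z y = f z' y)
    (hp : ∀ i, ∃ T : Set Y, T.Finite ∧ ∀ z z', (∀ y ∈ T, f z y = f z' y) → p z i = p z' i) :
    ∃ e : ↥(closure (Set.range p)) ≃ₜ ↥(closure (Set.range f)),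
      (∀ z h, (e ⟨p z, h⟩).1 = f z) ∧
      ∀ (a : (ι → K) → ι → K) (b : (Y → ℝ) → Y → ℝ) (γ : Z → Z), Continuous a → Continuous b →
        (∀ z, a (p z) = p (γ z)) → (∀ z, b (f z) = f (γ z)) →
        ∀ ξ ζ : ↥(closure (Set.range p)), a ξ.1 = ζ.1 → b (e ξ).1 = (e ζ).1 := by
  choose s hs hps using hfin
  choose I hI hIf using hf
  choose T hT hTp using hp
  have happ : ∀ (ξ : ↥(closure (Set.range p))) (y : Y), ∃ z, ∀ i ∈ I y, p z i = ξ.1 i :=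
    fun ξ y => exists_forall_eq_of_mem_closure_range ξ.2 (hI y)
  choose k hk using happ
  let F : ↥(closure (Set.range p)) → Y → ℝ := fun ξ y => f (k ξ y) y
  have hF : ∀ (ξ : ↥(closure (Set.range p))) y z, (∀ i ∈ I y, p z i = ξ.1 i) → f z y = F ξ y :=
    fun ξ y z h => hIf y _ _ fun i hi => (h i hi).trans (hk ξ y i hi).symm
  have hnhds : ∀ (ξ : ι → K) y, {η : ι → K | ∀ i ∈ I y, η i = ξ i} ∈ 𝓝 ξ := fun ξ y =>
    (isOpen_set_pi (hI y) fun i _ => isOpen_discrete {ξ i}).mem_nhds fun _ _ => rfl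
  have hlim : ∀ ξ : ↥(closure (Set.range p)), Tendsto f (comap p (𝓝 ξ.1)) (𝓝 (F ξ)) := by
    intro ξ
    refine tendsto_pi_nhds.2 fun y => tendsto_const_nhds.congr' ?_
    filter_upwards [preimage_mem_comap (hnhds ξ.1 y)] with z hz
    exact (hF ξ y z hz).symm
  have hFp : ∀ z h, F ⟨p z, h⟩ = f z := fun z h =>
    funext fun y => (hF ⟨p z, h⟩ y z fun _ _ => rfl).symm
  have hcont : Continuous F := by
    refine continuous_pi fun y => continuous_iff_continuousAt.2 fun ξ => ?_
    refine tendsto_const_nhds.congr' ?_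
    filter_upwards [continuous_subtype_val.continuousAt.preimage_mem_nhds (hnhds ξ.1 y)] with η hη
    exact hF η y (k ξ y) fun i hi => (hk ξ y i hi).trans (hη i hi).symm
  have hcomp : IsCompact (closure (Set.range p)) := by
    have hc : IsCompact (Set.univ.pi s) := isCompact_univ_pi fun i => (hs i).isCompact
    refine hc.of_isClosed_subset isClosed_closure (closure_minimal ?_ ?_)
    · rintro _ ⟨z, rfl⟩ i _
      exact hps i z
    · exact isClosed_set_pi fun i _ => isClosed_discrete _
  have : CompactSpace ↥(closure (Set.range p)) := isCompact_iff_compactSpace.1 hcomp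
  have hmem : ∀ ξ, F ξ ∈ closure (Set.range f) := fun ξ =>
    haveI := comap_nhds_neBot ξ.2
    mem_closure_of_tendsto (hlim ξ) (Eventually.of_forall fun z => ⟨z, rfl⟩)
  let F' : ↥(closure (Set.range p)) → ↥(closure (Set.range f)) := fun ξ => ⟨F ξ, hmem ξ⟩
  have hinj : Function.Injective F' := by
    intro ξ ξ' h
    refine Subtype.ext (funext fun i => ?_)
    have hfinite : (insert i (⋃ y ∈ T i, I y)).Finite :=
      ((hT i).biUnion fun y _ => hI y).insert i
    obtain ⟨z, hz⟩ := exists_forall_eq_of_mem_closure_range ξ.2 hfinite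
    obtain ⟨z', hz'⟩ := exists_forall_eq_of_mem_closure_range ξ'.2 hfinite
    rw [← hz i (Set.mem_insert _ _), ← hz' i (Set.mem_insert _ _)]
    refine hTp i _ _ fun y hy => ?_
    have hsub : I y ⊆ insert i (⋃ y ∈ T i, I y) := fun j hj =>
      Set.mem_insert_of_mem _ (Set.mem_biUnion hy hj)
    rw [hF ξ y z fun j hj => hz j (hsub hj), hF ξ' y z' fun j hj => hz' j (hsub hj)]
    exact congrFun (congrArg Subtype.val h) y
  have hsurj : Function.Surjective F' := by
    have hcl : closure (Set.range f) ⊆ Set.range F := by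
      refine closure_minimal ?_ (isCompact_range hcont).isClosed
      rintro _ ⟨z, rfl⟩
      exact ⟨⟨p z, subset_closure ⟨z, rfl⟩⟩, hFp z _⟩
    rintro ⟨φ, hφ⟩
    obtain ⟨ξ, rfl⟩ := hcl hφ
    exact ⟨ξ, rfl⟩
  have hcont' : Continuous (Equiv.ofBijective F' ⟨hinj, hsurj⟩) := hcont.subtype_mk hmem
  refine ⟨hcont'.homeoOfEquivCompactToT2, fun z h => hFp z h, ?_⟩
  intro a b γ ha hb hap hbf ξ ζ hξζ
  change b (F ξ) = F ζ
  have := comap_nhds_neBot ξ.2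
  have h1 : Tendsto (fun z => b (f z)) (comap p (𝓝 ξ.1)) (𝓝 (b (F ξ))) :=
    (hb.tendsto _).comp (hlim ξ)
  have h2 : Tendsto γ (comap p (𝓝 ξ.1)) (comap p (𝓝 ζ.1)) := by
    refine tendsto_comap_iff.2 ?_
    have h3 : Tendsto (fun z => a (p z)) (comap p (𝓝 ξ.1)) (𝓝 (a ξ.1)) :=
      (ha.tendsto _).comp tendsto_comap
    rw [hξζ] at h3
    exact h3.congr hap
  exact tendsto_nhds_unique h1 (((hlim ζ).comp h2).congr fun z => (hbf z).symm)

/-- If the differences `d z y - d z y'` along a connecting relation depend on finitely many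
coordinates `p z i`, then so do all differences. -/
theorem exists_finite_of_eqvGen {Z ι K Y : Type*} (p : Z → ι → K) (d : Z → Y → ℝ)
    {r : Y → Y → Prop} (hr : ∀ y y', r y y' → ∃ i, ∀ z z', p z i = p z' i →
      d z y - d z y' = d z' y - d z' y') {y y' : Y} (h : Relation.EqvGen r y y') :
    ∃ I : Set ι, I.Finite ∧ ∀ z z', (∀ i ∈ I, p z i = p z' i) →
      d z y - d z y' = d z' y - d z' y' := by
  induction h with
  | rel y y' h =>
    obtain ⟨i, hi⟩ := hr y y' h
    exact ⟨{i}, Set.finite_singleton i, fun z z' hz => hi z z' (hz i rfl)⟩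
  | refl y => exact ⟨∅, Set.finite_empty, fun z z' _ => by simp⟩
  | symm y y' _ ih =>
    obtain ⟨I, hI, h⟩ := ih
    exact ⟨I, hI, fun z z' hz => by linarith [h z z' hz]⟩
  | trans x y y' _ _ ih₁ ih₂ =>
    obtain ⟨I, hI, h⟩ := ih₁
    obtain ⟨J, hJ, h'⟩ := ih₂
    refine ⟨I ∪ J, hI.union hJ, fun z z' hz => ?_⟩
    linarith [h z z' fun i hi => hz i (Or.inl hi), h' z z' fun i hi => hz i (Or.inr hi)]

namespace Bldg

variable {cs : CoxeterSystem M W} {X : Bldg cs}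

/-- Any two chambers are connected by a gallery. -/
theorem eqvGen_panel (C D : X.Chamber) :
    Relation.EqvGen (fun C D => ∃ σ : X.Panel, C ∈ σ.1 ∧ D ∈ σ.1) C D := by
  induction hn : X.gdist C D generalizing D with
  | zero =>
    rw [gdist_eq_zero.1 hn]
    exact Relation.EqvGen.refl _
  | succ n ih =>
    obtain ⟨E, i, -, h1, h2⟩ := exists_last_step (C := C) (D := D) (by
      rw [Ne, X.delta_eq_one_iff, ← gdist_eq_zero]
      omega)
    refine Relation.EqvGen.trans _ E _ (ih E (by omega)) (Relation.EqvGen.rel _ _ ?_)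
    exact ⟨⟨_, i, E, rfl⟩, mem_residue_self _ E, mem_panel h1⟩

/-- Any two spherical residues are connected by a chain of nested residues. -/
theorem eqvGen_leRes (R T : X.Res) : Relation.EqvGen X.leRes R T := by
  have hch : ∀ C D : X.Chamber, Relation.EqvGen X.leRes
      ⟨X.residue ∅ C, ∅, C, sphType_empty, rfl⟩ ⟨X.residue ∅ D, ∅, D, sphType_empty, rfl⟩ := by
    intro C D
    have hsub : ∀ (σ : X.Panel) (E : X.Chamber), E ∈ σ.1 →
        X.leRes ⟨σ.1, σ.2.isSphResidue⟩ ⟨X.residue ∅ E, ∅, E, sphType_empty, rfl⟩ := by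
      intro σ E hE
      obtain ⟨I, -, e⟩ := σ.2.isSphResidue.exists_eq hE
      change X.residue ∅ E ⊆ σ.1
      rw [e]
      intro F hF
      exact Subgroup.closure_mono (Set.image_mono (Set.empty_subset I)) hF
    induction eqvGen_panel C D with
    | rel C D h =>
      obtain ⟨σ, hC, hD⟩ := h
      exact ((Relation.EqvGen.rel _ _ (hsub σ C hC)).symm).trans _ _ _
        (Relation.EqvGen.rel _ _ (hsub σ D hD))
    | refl C => exact Relation.EqvGen.refl _
    | symm C D _ ih => exact ih.symm
    | trans C D E _ _ ih₁ ih₂ => exact ih₁.trans _ _ _ ih₂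
  have hres : ∀ R : X.Res, ∃ C, X.leRes R ⟨X.residue ∅ C, ∅, C, sphType_empty, rfl⟩ := by
    intro R
    obtain ⟨I, C, hI, e⟩ := R.2
    refine ⟨C, ?_⟩
    change X.residue ∅ C ⊆ R.1
    rw [e]
    intro F hF
    exact Subgroup.closure_mono (Set.image_mono (Set.empty_subset I)) hF
  obtain ⟨C, hC⟩ := hres R
  obtain ⟨D, hD⟩ := hres T
  exact ((Relation.EqvGen.rel _ _ hC).trans _ _ _ (hch C D)).trans _ _ _
    (Relation.EqvGen.rel _ _ hD).symm

theorem continuous_actCr (g : X.Aut) : Continuous (X.actCr g) :=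
  continuous_pi fun σ => continuous_of_discreteTopology.comp (continuous_apply (X.actRes g⁻¹ σ))

theorem continuous_actCc (g : X.Aut) : Continuous (X.actCc g) :=
  continuous_pi fun σ => continuous_of_discreteTopology.comp (continuous_apply (X.actPanel g⁻¹ σ))

theorem continuous_actHoroCh (y₀ : X.Chamber) (g : X.Aut) : Continuous (X.actHoroCh y₀ g) :=
  continuous_pi fun _ => (continuous_apply _).sub (continuous_apply _)

theorem continuous_actHoroRes (z₀ : X.Res) (g : X.Aut) : Continuous (X.actHoroRes z₀ g) :=
  continuous_pi fun _ => (continuous_apply _).sub (continuous_apply _)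

theorem exists_homeomorph_horoCh (hlf : X.LocallyFinite) (y₀ : X.Chamber) :
    ∃ e : ↥X.Cc ≃ₜ ↥(X.horoCh y₀),
      (∀ C h, (e ⟨X.projc C, h⟩).1 = fun y => (X.gdist C y : ℝ) - (X.gdist C y₀ : ℝ)) ∧
      ∀ (g : X.Aut) (ξ ζ : ↥X.Cc), X.actCc g ξ.1 = ζ.1 →
        X.actHoroCh y₀ g (e ξ).1 = (e ζ).1 := by
  have hgate : ∀ (σ : X.Panel) (C D : X.Chamber), D ∈ σ.1 →
      (X.gdist C D : ℝ) = X.gdist C (X.projc C σ) + X.gdist (X.projc C σ) D := by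
    intro σ C D hD
    exact_mod_cast (σ.2.isSphResidue.isGate C).2 D hD
  have hr : ∀ y y' : X.Chamber, (∃ σ : X.Panel, y ∈ σ.1 ∧ y' ∈ σ.1) →
      ∃ σ, ∀ C C', X.projc C σ = X.projc C' σ →
        (X.gdist C y : ℝ) - X.gdist C y' = X.gdist C' y - X.gdist C' y' := by
    rintro y y' ⟨σ, hy, hy'⟩
    refine ⟨σ, fun C C' h => ?_⟩
    rw [hgate σ C y hy, hgate σ C y' hy', hgate σ C' y hy, hgate σ C' y' hy', h]
    ring
  have hinj : ∀ (σ : X.Panel) (C C' : X.Chamber), (∀ y ∈ σ.1,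
      (X.gdist C y : ℝ) - X.gdist C y₀ = X.gdist C' y - X.gdist C' y₀) →
      X.projc C σ = X.projc C' σ := by
    intro σ C C' h
    have ha : X.projc C σ ∈ σ.1 := σ.2.isSphResidue.gate_mem C
    have hb : X.projc C' σ ∈ σ.1 := σ.2.isSphResidue.gate_mem C'
    have h1 := h _ ha
    have h2 := h _ hb
    have h3 := hgate σ C _ hb
    have h4 := hgate σ C' _ ha
    rw [gdist_comm (X.projc C' σ)] at h4
    refine gdist_eq_zero.1 ?_
    have h5 : (X.gdist (X.projc C σ) (X.projc C' σ) : ℝ) = 0 := by linarith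
    exact_mod_cast h5
  obtain ⟨e, he, heq⟩ := exists_homeomorph_closure_range X.projc
    (fun C y => (X.gdist C y : ℝ) - (X.gdist C y₀ : ℝ))
    (fun σ => ⟨σ.1, hlf.2 σ.1 σ.2, fun C => σ.2.isSphResidue.gate_mem C⟩)
    (fun y => exists_finite_of_eqvGen X.projc (fun C y => (X.gdist C y : ℝ)) hr
      (eqvGen_panel y y₀))
    (fun σ => ⟨σ.1, hlf.2 σ.1 σ.2, hinj σ⟩)
  refine ⟨e, he, fun g => heq (X.actCc g) (X.actHoroCh y₀ g) g.1 (continuous_actCc g)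
    (continuous_actHoroCh y₀ g) (actCc_projc g) fun C => ?_⟩
  funext y
  simp only [actHoroCh, gdist_inv_apply]
  ring

theorem exists_homeomorph_horoRes (hlf : X.LocallyFinite) (z₀ : X.Res) :
    ∃ e : ↥X.Cr ≃ₜ ↥(X.horoRes z₀),
      (∀ R h, (e ⟨X.projr R, h⟩).1 = fun y => X.rootDist R y - X.rootDist R z₀) ∧
      ∀ (g : X.Aut) (ξ ζ : ↥X.Cr), X.actCr g ξ.1 = ζ.1 →
        X.actHoroRes z₀ g (e ξ).1 = (e ζ).1 := by
  have hr : ∀ y y' : X.Res, X.leRes y y' → ∃ σ, ∀ R R', X.projr R σ = X.projr R' σ →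
      X.rootDist R y - X.rootDist R y' = X.rootDist R' y - X.rootDist R' y' := by
    intro y y' hyy
    refine ⟨y, fun R R' h => ?_⟩
    have h1 := rootDist_sub_rootDist (R := R) hyy
    have h2 := rootDist_sub_rootDist (R := R') hyy
    rw [show X.projRes y R = X.projRes y R' from h] at h1
    linarith
  have hinj : ∀ (σ R R' : X.Res), (∀ y ∈ X.star σ,
      X.rootDist R y - X.rootDist R z₀ = X.rootDist R' y - X.rootDist R' z₀) →
      X.projr R σ = X.projr R' σ := fun σ R R' h =>
    projRes_eq_of_rootDist fun τ hτ => by linarith [h τ hτ, h σ (Set.Subset.refl σ.1)]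
  obtain ⟨e, he, heq⟩ := exists_homeomorph_closure_range X.projr
    (fun R y => X.rootDist R y - X.rootDist R z₀)
    (fun σ => ⟨X.star σ, finite_star hlf σ, fun R => projRes_subset σ R⟩)
    (fun y => exists_finite_of_eqvGen X.projr X.rootDist hr (eqvGen_leRes y z₀))
    (fun σ => ⟨X.star σ, finite_star hlf σ, hinj σ⟩)
  refine ⟨e, he, fun g => heq (X.actCr g) (X.actHoroRes z₀ g) (X.actRes g) (continuous_actCr g)
    (continuous_actHoroRes z₀ g) (actCr_projr g) fun R => ?_⟩
  funext y
  simp only [actHoroRes, rootDist_actRes_inv]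
  ring

end Bldg

/-- for a locally finite building, `Cc(X)` is `Aut(X)`-equivariantly
homeomorphic to the horofunction compactification of the chamber graph, and
`Cr(X)` is `Aut(X)`-equivariantly homeomorphic to the horofunction
compactification of `(Res(X), root-distance)`; the homeomorphisms extend the
canonical identifications. -/
theorem statement14 {cs : CoxeterSystem M W} (X : Bldg cs)
    (hlf : X.LocallyFinite) (y₀ : X.Chamber) (z₀ : X.Res) :
    (∃ e : ↥X.Cc ≃ₜ ↥(X.horoCh y₀),
      (∀ C : X.Chamber,
        ((e ⟨X.projc C, subset_closure (Set.mem_range_self C)⟩ : ↥(X.horoCh y₀)) :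
            X.Chamber → ℝ) =
          fun y => (X.gdist C y : ℝ) - (X.gdist C y₀ : ℝ)) ∧
      ∀ (g : X.Aut) (ξ ζ : ↥X.Cc), X.actCc g ξ.1 = ζ.1 →
        X.actHoroCh y₀ g (e ξ).1 = (e ζ).1) ∧
    (∃ e : ↥X.Cr ≃ₜ ↥(X.horoRes z₀),
      (∀ R : X.Res,
        ((e ⟨X.projr R, subset_closure (Set.mem_range_self R)⟩ : ↥(X.horoRes z₀)) :
            X.Res → ℝ) =
          fun y => X.rootDist R y - X.rootDist R z₀) ∧
      ∀ (g : X.Aut) (ξ ζ : ↥X.Cr), X.actCr g ξ.1 = ζ.1 →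
        X.actHoroRes z₀ g (e ξ).1 = (e ζ).1) := by
  obtain ⟨e, he, heq⟩ := Bldg.exists_homeomorph_horoCh hlf y₀
  obtain ⟨e', he', heq'⟩ := Bldg.exists_homeomorph_horoRes hlf z₀
  exact ⟨⟨e, fun C => he C _, heq⟩, ⟨e', fun R => he' R _, heq'⟩⟩
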